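/- There is a universal constant α > 0 such that the following holds. Let G = (X, Y, Q, Σ_X, Σ_Y, P) be a projection game in which Q is the uniform distribution over a set E ⊆ X × Y, let d_max be the maximum degree of a vertex in the bipartite graph (X, Y, E), and suppose val(G) = 1 − ε. Then for all integers 0 ≤ k ≤ |X| and 0 ≤ l ≤ |Y|, val(G^{k×l}) ≤ 2·(1 − ε/2)^{α·ε^3·k·l·|E| / (d_max·|X|·|Y|)}. -/

import Mathlib

open Finset

attribute [local instance] Classical.propDecidable

noncomputable section

/-- The value of a two-prover game with question sets `QX`, `QY`, answer sets `AX`, `AY`,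
question distribution `Q` and verification predicate `P`. -/
def gameVal {QX QY AX AY : Type*} [Fintype QX] [Fintype QY] [Fintype AX] [Fintype AY]
    [Nonempty AX] [Nonempty AY] (Q : QX → QY → ℝ) (P : QX → QY → AX → AY → Prop) : ℝ :=
  (Finset.univ : Finset ((QX → AX) × (QY → AY))).sup'
    ⟨(fun _ => Classical.arbitrary AX, fun _ => Classical.arbitrary AY), Finset.mem_univ _⟩
    fun φ => ∑ x : QX, ∑ y : QY, Q x y * (if P x y (φ.1 x) (φ.2 y) then 1 else 0)

/-- The uniform distribution over a finite set `E` of question pairs. -/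
def unifOn {QX QY : Type*} (E : Finset (QX × QY)) : QX → QY → ℝ :=
  fun x y => if (x, y) ∈ E then (E.card : ℝ)⁻¹ else 0

/-- Maximum degree of a vertex in the bipartite graph `(X, Y, E)`. -/
def maxDeg {X Y : Type*} [Fintype X] [Fintype Y] (E : Finset (X × Y)) : ℕ :=
  max (Finset.univ.sup fun x : X => (E.filter fun e => e.1 = x).card)
      (Finset.univ.sup fun y : Y => (E.filter fun e => e.2 = y).card)

/-- The predicate of a birthday-repetition game: all edges between `S` and `T` must be
answered acceptably. -/
def bPred {X Y AX AY : Type*} (E : Finset (X × Y)) (P : X → Y → AX → AY → Prop) :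
    Finset X → Finset Y → (X → AX) → (Y → AY) → Prop :=
  fun S T a b => ∀ x ∈ S, ∀ y ∈ T, (x, y) ∈ E → P x y (a x) (b y)

/-- Value of the `(k × l)`-birthday repetition `G^{k×l}`: questions are uniformly random
`k`-subsets of `X` and `l`-subsets of `Y`. -/
def birthdayVal {X Y AX AY : Type*} [Fintype X] [Fintype Y] [Fintype AX] [Fintype AY]
    [Nonempty AX] [Nonempty AY] (E : Finset (X × Y)) (P : X → Y → AX → AY → Prop)
    (k l : ℕ) : ℝ :=
  gameVal
    (fun (S : Finset X) (T : Finset Y) =>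
      if S.card = k ∧ T.card = l then
        (((Fintype.card X).choose k : ℝ) * ((Fintype.card Y).choose l : ℝ))⁻¹
      else 0)
    (bPred E P)

/-- Value of the `r`-fold parallel repetition `G^{⊗r}`. -/
def parVal {X Y AX AY : Type*} [Fintype X] [Fintype Y] [Fintype AX] [Fintype AY]
    [Nonempty AX] [Nonempty AY] (Q : X → Y → ℝ) (P : X → Y → AX → AY → Prop) (r : ℕ) : ℝ :=
  gameVal (fun (xs : Fin r → X) (ys : Fin r → Y) => ∏ i, Q (xs i) (ys i))
    (fun xs ys (a : Fin r → AX) (b : Fin r → AY) => ∀ i, P (xs i) (ys i) (a i) (b i))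

/-- `E^r_set` : tuples of `r` edges of `E` whose endpoints are all distinct. -/
def ErSet {X Y : Type*} [Fintype X] [Fintype Y] (E : Finset (X × Y)) (r : ℕ) :
    Finset ((Fin r → X) × (Fin r → Y)) :=
  Finset.univ.filter fun p =>
    (∀ i, (p.1 i, p.2 i) ∈ E) ∧ Function.Injective p.1 ∧ Function.Injective p.2

/-- Value of `G^{⊗r}_set are`, the parallel repetition with question distribution uniform
over `E^r_set`. -/
def parSetVal {X Y AX AY : Type*} [Fintype X] [Fintype Y] [Fintype AX] [Fintype AY]
    [Nonempty AX] [Nonempty AY] (E : Finset (X × Y)) (P : X → Y → AX → AY → Prop)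
    (r : ℕ) : ℝ :=
  gameVal (fun xs ys => if (xs, ys) ∈ ErSet E r then ((ErSet E r).card : ℝ)⁻¹ else 0)
    (fun xs ys (a : Fin r → AX) (b : Fin r → AY) => ∀ i, P (xs i) (ys i) (a i) (b i))

/-- The distribution `Q^{k×l}_em`: sample a tuple of `r` disjoint edges uniformly from
`E^r_set`, then complete the endpoints to a uniformly random `k`-subset of `X` and
`l`-subset of `Y`. -/
def Qem {X Y : Type*} [Fintype X] [Fintype Y] (E : Finset (X × Y)) (r k l : ℕ) :
    Finset X → Finset Y → ℝ :=
  fun S T =>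
    ((ErSet E r).card : ℝ)⁻¹ *
      ∑ p ∈ ErSet E r,
        (if S.card = k ∧ T.card = l ∧ (∀ i, p.1 i ∈ S) ∧ (∀ i, p.2 i ∈ T) then
            (((Fintype.card X - r).choose (k - r) : ℝ) *
              ((Fintype.card Y - r).choose (l - r) : ℝ))⁻¹
          else 0)

/-- Value of `G^{k×l}_em`. -/
def birthdayEmVal {X Y AX AY : Type*} [Fintype X] [Fintype Y] [Fintype AX] [Fintype AY]
    [Nonempty AX] [Nonempty AY] (E : Finset (X × Y)) (P : X → Y → AX → AY → Prop)
    (r k l : ℕ) : ℝ :=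
  gameVal (Qem E r k l) (bPred E P)

/-- `|E(S, T)|`, the number of edges between `S` and `T`. -/
def edgeCount {X Y : Type*} (E : Finset (X × Y)) (S : Finset X) (T : Finset Y) : ℕ :=
  (E.filter fun e => e.1 ∈ S ∧ e.2 ∈ T).card

/-- The event `(1 - δ)·s ≤ |E(S,T)| ≤ (1 + δ)·s`. -/
def inRange {X Y : Type*} (E : Finset (X × Y)) (s δ : ℝ) (S : Finset X) (T : Finset Y) :
    Prop :=
  (1 - δ) * s ≤ (edgeCount E S T : ℝ) ∧ (edgeCount E S T : ℝ) ≤ (1 + δ) * s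

/-- Conditioning a distribution on an event `A`. -/
def condOn {QX QY : Type*} [Fintype QX] [Fintype QY] (Q : QX → QY → ℝ)
    (A : QX → QY → Prop) : QX → QY → ℝ :=
  fun x y =>
    if A x y then Q x y / (∑ x' : QX, ∑ y' : QY, if A x' y' then Q x' y' else 0) else 0

/-- Value of `G^{k×l}_{em,[s₁,s₂]}`. -/
def birthdayEmCondVal {X Y AX AY : Type*} [Fintype X] [Fintype Y] [Fintype AX] [Fintype AY]
    [Nonempty AX] [Nonempty AY] (E : Finset (X × Y)) (P : X → Y → AX → AY → Prop)
    (r k l : ℕ) (s δ : ℝ) : ℝ :=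
  gameVal (condOn (Qem E r k l) (inRange E s δ)) (bPred E P)

/-- The set `E^{k×l}_{[s₁,s₂]}` of pairs `(S, T)` with `|S| = k`, `|T| = l` and
`(1-δ)·s ≤ |E(S,T)| ≤ (1+δ)·s`. -/
def rangeSet {X Y : Type*} [Fintype X] [Fintype Y] (E : Finset (X × Y)) (k l : ℕ)
    (s δ : ℝ) : Finset (Finset X × Finset Y) :=
  Finset.univ.filter fun p => p.1.card = k ∧ p.2.card = l ∧ inRange E s δ p.1 p.2

/-- Value of `G^{k×l}_{[s₁,s₂]}`. -/
def birthdayRangeVal {X Y AX AY : Type*} [Fintype X] [Fintype Y] [Fintype AX] [Fintype AY]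
    [Nonempty AX] [Nonempty AY] (E : Finset (X × Y)) (P : X → Y → AX → AY → Prop)
    (k l : ℕ) (s δ : ℝ) : ℝ :=
  gameVal
    (fun S T => if (S, T) ∈ rangeSet E k l s δ then ((rangeSet E k l s δ).card : ℝ)⁻¹ else 0)
    (bPred E P)

universe u₁ u₂ u₃ u₄

theorem sum_perm_prod_mul_le {X : Type*} [Fintype X] (z : X → ℝ) (hz : ∀ x, 0 ≤ z x)
    (I : Finset X) (a b : X) (hb : b ∉ I) :
    ∑ π : Equiv.Perm X, (∏ i ∈ I, z (π i)) * z (π b) ≤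
      ∑ π : Equiv.Perm X, (∏ i ∈ I, z (π i)) * z (π a) := by
  have key : ∀ c : X, ∑ π : Equiv.Perm X, (∏ i ∈ I, z (π i)) * z (π c) =
      ∑ π : Equiv.Perm X, (∏ i ∈ I, z (π (Equiv.swap a b i))) * z (π (Equiv.swap a b c)) :=
    fun c => (Equiv.sum_comp (Equiv.mulRight (Equiv.swap a b))
      (fun π : Equiv.Perm X => (∏ i ∈ I, z (π i)) * z (π c))).symm
  have h1 := key a
  have h2 := key b
  rw [Equiv.swap_apply_left] at h1
  rw [Equiv.swap_apply_right] at h2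
  have h3 : 0 ≤ ∑ π : Equiv.Perm X,
      (∏ i ∈ I, z (π i) - ∏ i ∈ I, z (π (Equiv.swap a b i))) * (z (π a) - z (π b)) := by
    refine Finset.sum_nonneg fun π _ => ?_
    by_cases ha : a ∈ I
    · rw [← Finset.mul_prod_erase I _ ha, ← Finset.mul_prod_erase I _ ha, Equiv.swap_apply_left]
      have h4 : ∏ i ∈ I.erase a, z (π (Equiv.swap a b i)) = ∏ i ∈ I.erase a, z (π i) := by
        refine Finset.prod_congr rfl fun i hi => ?_
        rw [Equiv.swap_apply_of_ne_of_ne (Finset.ne_of_mem_erase hi)]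
        rintro rfl
        exact hb (Finset.mem_of_mem_erase hi)
      rw [h4]
      have h5 : 0 ≤ ∏ i ∈ I.erase a, z (π i) := Finset.prod_nonneg fun i _ => hz _
      nlinarith [mul_nonneg h5 (sq_nonneg (z (π a) - z (π b)))]
    · have h4 : ∏ i ∈ I, z (π (Equiv.swap a b i)) = ∏ i ∈ I, z (π i) := by
        refine Finset.prod_congr rfl fun i hi => ?_
        rw [Equiv.swap_apply_of_ne_of_ne]
        · rintro rfl; exact ha hi
        · rintro rfl; exact hb hi
      simp [h4]
  simp only [sub_mul, mul_sub, Finset.sum_sub_distrib] at h3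
  linarith

/-- Sampling without replacement: the expected product of nonnegative values is at most the
product of the expectations. -/
theorem sum_perm_prod_le {X : Type*} [Fintype X] (z : X → ℝ) (hz : ∀ x, 0 ≤ z x)
    (I : Finset X) :
    (Fintype.card X : ℝ) ^ I.card * ∑ π : Equiv.Perm X, ∏ i ∈ I, z (π i) ≤
      Fintype.card (Equiv.Perm X) * (∑ x, z x) ^ I.card := by
  induction I using Finset.induction_on with
  | empty => simp
  | insert b I hb ih =>
    rw [Finset.card_insert_of_notMem hb]
    have h1 : (Fintype.card X : ℝ) * ∑ π : Equiv.Perm X, ∏ i ∈ insert b I, z (π i) ≤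
        (∑ π : Equiv.Perm X, ∏ i ∈ I, z (π i)) * ∑ x, z x := by
      calc (Fintype.card X : ℝ) * ∑ π : Equiv.Perm X, ∏ i ∈ insert b I, z (π i)
          = ∑ _a : X, ∑ π : Equiv.Perm X, (∏ i ∈ I, z (π i)) * z (π b) := by
            simp [Finset.prod_insert hb, mul_comm]
        _ ≤ ∑ a : X, ∑ π : Equiv.Perm X, (∏ i ∈ I, z (π i)) * z (π a) :=
            Finset.sum_le_sum fun a _ => sum_perm_prod_mul_le z hz I a b hb
        _ = _ := by
            rw [Finset.sum_comm, Finset.sum_mul]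
            refine Finset.sum_congr rfl fun π _ => ?_
            rw [← Finset.mul_sum, Equiv.sum_comp π z]
    calc _ = (Fintype.card X : ℝ) ^ I.card *
          ((Fintype.card X : ℝ) * ∑ π : Equiv.Perm X, ∏ i ∈ insert b I, z (π i)) := by ring
      _ ≤ (Fintype.card X : ℝ) ^ I.card *
          ((∑ π : Equiv.Perm X, ∏ i ∈ I, z (π i)) * ∑ x, z x) := by gcongr
      _ = ((Fintype.card X : ℝ) ^ I.card *
          (∑ π : Equiv.Perm X, ∏ i ∈ I, z (π i))) * ∑ x, z x := by ring
      _ ≤ (Fintype.card (Equiv.Perm X) * (∑ x, z x) ^ I.card) * ∑ x, z x := by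
          gcongr
          exact Finset.sum_nonneg fun x _ => hz x
      _ = _ := by ring

theorem exists_perm_map_eq {X : Type*} [Fintype X] {S T : Finset X} (h : S.card = T.card) :
    ∃ σ : Equiv.Perm X, S.map σ.toEmbedding = T := by
  have e : {x // x ∈ S} ≃ {x // x ∈ T} := Fintype.equivOfCardEq (by simpa using h)
  refine ⟨e.extendSubtype, ?_⟩
  refine Finset.eq_of_subset_of_card_le ?_ (by simp [h])
  intro x hx
  obtain ⟨y, hy, rfl⟩ := Finset.mem_map.1 hx
  exact Equiv.extendSubtype_mem e y hy

/-- The image of a fixed `k`-set under a uniformly random permutation is a uniformly random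
`k`-set. -/
theorem choose_mul_sum_perm {X : Type*} [Fintype X] (F : Finset X → ℝ) (S₀ : Finset X) :
    ((Fintype.card X).choose S₀.card : ℝ) *
        ∑ π : Equiv.Perm X, F (S₀.map π.toEmbedding) =
      Fintype.card (Equiv.Perm X) *
        ∑ S ∈ powersetCard S₀.card (univ : Finset X), F S := by
  have fib : ∀ F : Finset X → ℝ, ∑ π : Equiv.Perm X, F (S₀.map π.toEmbedding) =
      ∑ S ∈ powersetCard S₀.card (univ : Finset X),
        ((univ.filter fun π : Equiv.Perm X => S₀.map π.toEmbedding = S).card : ℝ) * F S := by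
    intro F
    rw [← Finset.sum_fiberwise_of_maps_to (s := univ)
      (t := powersetCard S₀.card (univ : Finset X))
      (g := fun π : Equiv.Perm X => S₀.map π.toEmbedding) (by simp [mem_powersetCard])]
    refine Finset.sum_congr rfl fun S _ => ?_
    rw [Finset.sum_congr rfl (g := fun _ => F S) (fun π hπ => by rw [(mem_filter.1 hπ).2])]
    simp
  have cst : ∀ S ∈ powersetCard S₀.card (univ : Finset X),
      (univ.filter fun π : Equiv.Perm X => S₀.map π.toEmbedding = S).card =
        (univ.filter fun π : Equiv.Perm X => S₀.map π.toEmbedding = S₀).card := by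
    intro S hS
    obtain ⟨σ, hσ⟩ := exists_perm_map_eq (mem_powersetCard.1 hS).2.symm
    symm
    refine Finset.card_bij (fun π _ => σ * π) ?_ ?_ ?_
    · intro π hπ
      simp only [mem_filter, mem_univ, true_and] at hπ ⊢
      rw [← hσ]
      nth_rewrite 2 [← hπ]
      rw [Finset.map_map]
      rfl
    · intro a _ b _ hab
      exact mul_left_cancel hab
    · intro π hπ
      simp only [mem_filter, mem_univ, true_and] at hπ
      refine ⟨σ⁻¹ * π, ?_, by simp⟩
      simp only [mem_filter, mem_univ, true_and]
      have h1 : S₀.map (σ⁻¹ * π).toEmbedding = S.map (σ⁻¹ : Equiv.Perm X).toEmbedding := by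
        rw [← hπ, Finset.map_map]; rfl
      rw [h1, ← hσ, Finset.map_map]
      ext x
      simp
  have fib' : ∀ F : Finset X → ℝ, ∑ π : Equiv.Perm X, F (S₀.map π.toEmbedding) =
      ((univ.filter fun π : Equiv.Perm X => S₀.map π.toEmbedding = S₀).card : ℝ) *
        ∑ S ∈ powersetCard S₀.card (univ : Finset X), F S := by
    intro F
    rw [fib, Finset.mul_sum]
    exact Finset.sum_congr rfl fun S hS => by rw [cst S hS]
  have h0 := fib' (fun _ => 1)
  simp only [sum_const, card_powersetCard, card_univ, nsmul_eq_mul, mul_one] at h0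
  rw [fib', h0]
  ring

theorem sum_powersetCard_prod_le {X : Type*} [Fintype X] (z : X → ℝ) (hz : ∀ x, 0 ≤ z x)
    {k : ℕ} (hk : k ≤ Fintype.card X) :
    (Fintype.card X : ℝ) ^ k * ∑ S ∈ powersetCard k (univ : Finset X), ∏ x ∈ S, z x ≤
      (Fintype.card X).choose k * (∑ x, z x) ^ k := by
  obtain ⟨S₀, -, hS₀⟩ := Finset.exists_subset_card_eq (s := (univ : Finset X)) (n := k)
    (by simpa using hk)
  subst hS₀
  have h1 := choose_mul_sum_perm (fun S => ∏ x ∈ S, z x) S₀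
  have h2 := sum_perm_prod_le z hz S₀
  simp only [Finset.prod_map, Equiv.coe_toEmbedding] at h1
  have h3 : (0 : ℝ) < Fintype.card (Equiv.Perm X) := by exact_mod_cast Fintype.card_pos
  refine le_of_mul_le_mul_left ?_ h3
  calc _ = (Fintype.card X : ℝ) ^ S₀.card * (Fintype.card (Equiv.Perm X) *
        ∑ S ∈ powersetCard S₀.card (univ : Finset X), ∏ x ∈ S, z x) := by ring
    _ = ((Fintype.card X).choose S₀.card : ℝ) * ((Fintype.card X : ℝ) ^ S₀.card *
          ∑ π : Equiv.Perm X, ∏ i ∈ S₀, z (π i)) := by rw [← h1]; ring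
    _ ≤ ((Fintype.card X).choose S₀.card : ℝ) *
          (Fintype.card (Equiv.Perm X) * (∑ x, z x) ^ S₀.card) := by gcongr
    _ = _ := by ring

theorem card_superset_le {X : Type*} [Fintype X] [Nonempty X] (I : Finset X)
    {k : ℕ} (hk : k ≤ Fintype.card X) :
    (((powersetCard k (univ : Finset X)).filter fun S => I ⊆ S).card : ℝ) ≤
      (Fintype.card X).choose k * ((k : ℝ) / Fintype.card X) ^ I.card := by
  obtain ⟨S₀, -, hS₀⟩ := Finset.exists_subset_card_eq (s := (univ : Finset X)) (n := k)
    (by simpa using hk)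
  subst hS₀
  have h1 := choose_mul_sum_perm (fun S => if I ⊆ S then (1 : ℝ) else 0) S₀
  have h2 := sum_perm_prod_le (fun x => if x ∈ S₀ then (1 : ℝ) else 0)
    (fun x => by positivity) I
  have h3 : (0 : ℝ) < Fintype.card (Equiv.Perm X) := by exact_mod_cast Fintype.card_pos
  have h4 : (0 : ℝ) < Fintype.card X := by exact_mod_cast Fintype.card_pos
  have h5 : ∑ π : Equiv.Perm X, ∏ i ∈ I, (if π i ∈ S₀ then (1 : ℝ) else 0) =
      ∑ π : Equiv.Perm X, if I ⊆ S₀.map π.toEmbedding then (1 : ℝ) else 0 := by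
    rw [← Equiv.sum_comp (Equiv.inv (Equiv.Perm X))]
    refine Finset.sum_congr rfl fun π _ => ?_
    by_cases h : I ⊆ S₀.map π.toEmbedding
    · rw [if_pos h]
      exact Finset.prod_eq_one fun i hi => if_pos (Finset.mem_map_equiv.1 (h hi))
    · rw [if_neg h]
      obtain ⟨i, hi, hi'⟩ := Finset.not_subset.1 h
      exact Finset.prod_eq_zero hi (if_neg fun h' => hi' (Finset.mem_map_equiv.2 h'))
  rw [h5] at h2
  simp only [Finset.sum_boole, Finset.filter_mem_eq_inter, Finset.univ_inter] at h1 h2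
  rw [div_pow, mul_div_assoc', le_div_iff₀ (by positivity)]
  refine le_of_mul_le_mul_left ?_ h3
  set A : ℝ := ((univ.filter fun π : Equiv.Perm X => I ⊆ S₀.map π.toEmbedding).card : ℝ)
  calc _ = (Fintype.card (Equiv.Perm X) *
        (((powersetCard S₀.card (univ : Finset X)).filter fun S => I ⊆ S).card : ℝ)) *
          (Fintype.card X : ℝ) ^ I.card := by ring
    _ = ((Fintype.card X).choose S₀.card : ℝ) * ((Fintype.card X : ℝ) ^ I.card * A) := by
        rw [← h1]; ring
    _ ≤ ((Fintype.card X).choose S₀.card : ℝ) *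
          (Fintype.card (Equiv.Perm X) * (S₀.card : ℝ) ^ I.card) := by gcongr
    _ = _ := by ring

theorem exp_neg_le_quadratic {v : ℝ} (hv : 0 ≤ v) : Real.exp (-v) ≤ 1 - v + v ^ 2 / 2 := by
  have h := Real.quadratic_le_exp_of_nonneg hv
  rw [Real.exp_neg, inv_le_iff_one_le_mul₀ (Real.exp_pos v)]
  have h2 : 0 ≤ 1 - v + v ^ 2 / 2 := by nlinarith [sq_nonneg (v - 1)]
  nlinarith [mul_le_mul_of_nonneg_left h h2, sq_nonneg (v ^ 2)]

theorem sum_powersetCard_exp_le {X : Type*} [Fintype X] [Nonempty X] (v : X → ℝ) {c : ℝ}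
    (hv : ∀ x, 0 ≤ v x) (hvc : ∀ x, v x ≤ c) {k : ℕ} (hk : k ≤ Fintype.card X) :
    ∑ S ∈ powersetCard k (univ : Finset X), Real.exp (-∑ x ∈ S, v x) ≤
      (Fintype.card X).choose k *
        Real.exp (-((1 - c / 2) * ((k : ℝ) / Fintype.card X) * ∑ x, v x)) := by
  have h4 : (0 : ℝ) < Fintype.card X := by exact_mod_cast Fintype.card_pos
  have h1 := sum_powersetCard_prod_le (fun x => Real.exp (-v x)) (fun x => (Real.exp_pos _).le) hk
  simp only [← Real.exp_sum, Finset.sum_neg_distrib] at h1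
  set A := (1 - c / 2) * ∑ x, v x with hA
  have h2 : ∑ x, Real.exp (-v x) ≤ Fintype.card X * Real.exp (-(A / Fintype.card X)) := by
    calc ∑ x, Real.exp (-v x) ≤ ∑ x, (1 - (1 - c / 2) * v x) := by
          refine Finset.sum_le_sum fun x _ => (exp_neg_le_quadratic (hv x)).trans ?_
          nlinarith [mul_le_mul_of_nonneg_left (hvc x) (hv x)]
      _ = Fintype.card X - A := by
          rw [Finset.sum_sub_distrib, ← Finset.mul_sum]; simp [hA]
      _ = Fintype.card X * (1 - A / Fintype.card X) := by field_simp
      _ ≤ _ := by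
          gcongr
          exact Real.one_sub_le_exp_neg _
  have h3 : (∑ x, Real.exp (-v x)) ^ k ≤ (Fintype.card X : ℝ) ^ k *
      Real.exp (-((1 - c / 2) * ((k : ℝ) / Fintype.card X) * ∑ x, v x)) := by
    refine (pow_le_pow_left₀ (Finset.sum_nonneg fun x _ => (Real.exp_pos _).le) h2 k).trans
      (le_of_eq ?_)
    rw [mul_pow, ← Real.exp_nat_mul]
    congr 2
    rw [hA]; field_simp
  refine le_of_mul_le_mul_left ?_ (pow_pos h4 k)
  refine h1.trans ((mul_le_mul_of_nonneg_left h3 (Nat.cast_nonneg _)).trans (le_of_eq ?_))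
  ring

theorem card_filter_mem_eq_sum {X ι : Type*} (E : Finset ι) (g : ι → X) (S : Finset X) :
    (E.filter fun e => g e ∈ S).card = ∑ x ∈ S, (E.filter fun e => g e = x).card := by
  rw [Finset.card_eq_sum_card_fiberwise (f := g) (t := S) (by intro e he; simp_all)]
  refine Finset.sum_congr rfl fun x hx => ?_
  congr 1
  ext e
  simp only [mem_filter]
  constructor
  · rintro ⟨⟨h1, -⟩, h2⟩
    exact ⟨h1, h2⟩
  · rintro ⟨h1, rfl⟩
    exact ⟨⟨h1, hx⟩, rfl⟩

theorem sum_exp_edgeCount_le {X Y : Type*} [Fintype X] [Fintype Y] (E : Finset (X × Y))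
    (hE : E.Nonempty) {d : ℝ} (hd : 0 < d)
    (hdX : ∀ x, ((E.filter fun e => e.1 = x).card : ℝ) ≤ d)
    (hdY : ∀ y, ((E.filter fun e => e.2 = y).card : ℝ) ≤ d)
    {k l : ℕ} (hk : k ≤ Fintype.card X) (hl : l ≤ Fintype.card Y)
    {t : ℝ} (ht0 : 0 ≤ t) (ht1 : t ≤ 1) :
    ∑ S ∈ powersetCard k (univ : Finset X), ∑ T ∈ powersetCard l (univ : Finset Y),
        Real.exp (-(t * edgeCount E S T / d)) ≤
      (Fintype.card X).choose k * (Fintype.card Y).choose l *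
        Real.exp (-((t - t ^ 2) *
          ((k : ℝ) * l * E.card / (d * Fintype.card X * Fintype.card Y)))) := by
  obtain ⟨⟨x₀, y₀⟩, -⟩ := hE
  have : Nonempty X := ⟨x₀⟩
  have : Nonempty Y := ⟨y₀⟩
  have hn : (0 : ℝ) < Fintype.card X := by exact_mod_cast Fintype.card_pos
  have hm : (0 : ℝ) < Fintype.card Y := by exact_mod_cast Fintype.card_pos
  have hlm : (l : ℝ) / Fintype.card Y ≤ 1 := by
    rw [div_le_one hm]; exact_mod_cast hl
  set c : ℝ := (1 - t / 2) * ((l : ℝ) / Fintype.card Y) * (t / d) with hc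
  have hl0 : (0 : ℝ) ≤ (l : ℝ) / Fintype.card Y := by positivity
  have hc0 : 0 ≤ c := by
    have : 0 ≤ 1 - t / 2 := by linarith
    positivity
  have inner : ∀ S : Finset X, ∑ T ∈ powersetCard l (univ : Finset Y),
      Real.exp (-(t * edgeCount E S T / d)) ≤ (Fintype.card Y).choose l *
        Real.exp (-∑ x ∈ S, c * ((E.filter fun e => e.1 = x).card : ℝ)) := by
    intro S
    have h := sum_powersetCard_exp_le
      (fun y : Y => t / d * (((E.filter fun e => e.1 ∈ S).filter fun e => e.2 = y).card : ℝ))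
      (c := t) (fun y => by positivity) ?_ hl
    · convert h using 2 with T hT
      · simp only [← Finset.mul_sum]
        rw [← Nat.cast_sum, ← card_filter_mem_eq_sum, Finset.filter_filter, edgeCount]
        congr 1
        ring
      · simp only [← Finset.mul_sum]
        rw [← Nat.cast_sum, ← Nat.cast_sum, ← card_filter_mem_eq_sum, ← card_filter_mem_eq_sum]
        simp only [mem_univ, Finset.filter_true]
        rw [hc]; ring_nf
    · intro y
      have : (((E.filter fun e => e.1 ∈ S).filter fun e => e.2 = y).card : ℝ) ≤ d := by
        refine le_trans ?_ (hdY y)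
        exact_mod_cast Finset.card_le_card (Finset.filter_subset_filter _ (Finset.filter_subset _ _))
      calc _ ≤ t / d * d := by gcongr
        _ = t := by field_simp
  have outer := sum_powersetCard_exp_le
      (fun x : X => c * ((E.filter fun e => e.1 = x).card : ℝ)) (c := t)
      (fun x => by positivity) ?_ hk
  · calc _ ≤ ∑ S ∈ powersetCard k (univ : Finset X), ((Fintype.card Y).choose l : ℝ) *
          Real.exp (-∑ x ∈ S, c * ((E.filter fun e => e.1 = x).card : ℝ)) :=
          Finset.sum_le_sum fun S _ => inner S
      _ ≤ ((Fintype.card Y).choose l : ℝ) * ((Fintype.card X).choose k *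
          Real.exp (-((1 - t / 2) * ((k : ℝ) / Fintype.card X) *
            ∑ x, c * ((E.filter fun e => e.1 = x).card : ℝ)))) := by
          rw [← Finset.mul_sum]
          exact mul_le_mul_of_nonneg_left outer (Nat.cast_nonneg _)
      _ = (Fintype.card X).choose k * (Fintype.card Y).choose l *
          Real.exp (-((1 - t / 2) ^ 2 * t *
          ((k : ℝ) * l * E.card / (d * Fintype.card X * Fintype.card Y)))) := by
          rw [← Finset.mul_sum, ← Nat.cast_sum, ← card_filter_mem_eq_sum]
          simp only [mem_univ, Finset.filter_true]
          rw [mul_left_comm, ← mul_assoc, hc]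
          congr 2
          field_simp
      _ ≤ _ := by
          gcongr
          nlinarith [mul_nonneg ht0 (sq_nonneg t)]
  · intro x
    calc c * ((E.filter fun e => e.1 = x).card : ℝ) ≤ c * d :=
          mul_le_mul_of_nonneg_left (hdX x) hc0
      _ = (1 - t / 2) * ((l : ℝ) / Fintype.card Y) * t := by rw [hc]; field_simp
      _ ≤ 1 * 1 * t := by
          gcongr
          linarith
      _ = t := by ring

/-- Lower tail bound for the number of edges between a random `k`-set and a random `l`-set. -/
theorem card_edgeCount_lt_le {X Y : Type*} [Fintype X] [Fintype Y] (E : Finset (X × Y))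
    (hE : E.Nonempty) {d : ℝ} (hd : 0 < d)
    (hdX : ∀ x, ((E.filter fun e => e.1 = x).card : ℝ) ≤ d)
    (hdY : ∀ y, ((E.filter fun e => e.2 = y).card : ℝ) ≤ d)
    {k l : ℕ} (hk : k ≤ Fintype.card X) (hl : l ≤ Fintype.card Y)
    {δ μ : ℝ} (hδ0 : 0 ≤ δ) (hδ1 : δ ≤ 1)
    (hμ : μ = (k : ℝ) * l * E.card / (d * Fintype.card X * Fintype.card Y)) :
    ∑ S ∈ powersetCard k (univ : Finset X), ∑ T ∈ powersetCard l (univ : Finset Y),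
        (if (edgeCount E S T : ℝ) < (1 - δ) * (d * μ) then (1 : ℝ) else 0) ≤
      (Fintype.card X).choose k * (Fintype.card Y).choose l * Real.exp (-(δ ^ 2 * μ / 4)) := by
  have h := sum_exp_edgeCount_le E hE hd hdX hdY hk hl (t := δ / 2) (by linarith) (by linarith)
  rw [← hμ] at h
  calc _ ≤ ∑ S ∈ powersetCard k (univ : Finset X), ∑ T ∈ powersetCard l (univ : Finset Y),
        Real.exp (δ / 2 * ((1 - δ) * μ)) * Real.exp (-(δ / 2 * edgeCount E S T / d)) := by
        refine Finset.sum_le_sum fun S _ => Finset.sum_le_sum fun T _ => ?_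
        split_ifs with h1
        · rw [← Real.exp_add, Real.one_le_exp_iff]
          have h2 : (edgeCount E S T : ℝ) / d ≤ (1 - δ) * μ := by
            rw [div_le_iff₀ hd]; linarith
          rw [mul_div_assoc]
          nlinarith [mul_le_mul_of_nonneg_left h2 (show 0 ≤ δ / 2 by linarith)]
        · positivity
    _ = Real.exp (δ / 2 * ((1 - δ) * μ)) *
        ∑ S ∈ powersetCard k (univ : Finset X), ∑ T ∈ powersetCard l (univ : Finset Y),
          Real.exp (-(δ / 2 * edgeCount E S T / d)) := by
        simp only [Finset.mul_sum]
    _ ≤ Real.exp (δ / 2 * ((1 - δ) * μ)) * _ := mul_le_mul_of_nonneg_left h (by positivity)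
    _ = _ := by
        rw [mul_left_comm, ← Real.exp_add]
        congr 2
        ring

theorem card_ErSet_ge {X Y : Type*} [Fintype X] [Fintype Y] (E : Finset (X × Y)) {d c : ℝ}
    (hd : 0 ≤ d) (hdX : ∀ x, ((E.filter fun e => e.1 = x).card : ℝ) ≤ d)
    (hdY : ∀ y, ((E.filter fun e => e.2 = y).card : ℝ) ≤ d)
    (hc : 0 ≤ c) (r : ℕ) (hr : c + 2 * r * d ≤ E.card) :
    c ^ r ≤ ((ErSet E r).card : ℝ) := by
  induction r with
  | zero =>
    have : (ErSet E 0).card = 1 := by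
      simp [ErSet, Function.injective_of_subsingleton, Fintype.card_prod]
    simp [this]
  | succ r ih =>
    push_cast at hr
    have ih := ih (by nlinarith)
    set free : (Fin r → X) × (Fin r → Y) → Finset (X × Y) := fun p =>
      E.filter fun e => ∀ i, e.1 ≠ p.1 i ∧ e.2 ≠ p.2 i with hfree
    have hcount : ∀ p, c ≤ ((free p).card : ℝ) := by
      intro p
      have hsub : E \ free p ⊆ (univ : Finset (Fin r)).biUnion fun i =>
          (E.filter fun e => e.1 = p.1 i) ∪ (E.filter fun e => e.2 = p.2 i) := by
        intro e he
        simp only [hfree, mem_sdiff, mem_filter, not_and, not_forall] at he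
        obtain ⟨heE, he⟩ := he
        obtain ⟨i, hi⟩ := he heE
        simp only [mem_biUnion, mem_univ, true_and, mem_union, mem_filter, heE]
        refine ⟨i, ?_⟩
        by_contra hcon
        push Not at hcon
        exact hcon.2 (not_not.1 (fun h => hi hcon.1 h))
      have h1 : ((E \ free p).card : ℝ) ≤ r * (2 * d) := by
        calc ((E \ free p).card : ℝ) ≤ ∑ i : Fin r,
              (((E.filter fun e => e.1 = p.1 i) ∪ (E.filter fun e => e.2 = p.2 i)).card : ℝ) := by
              exact_mod_cast (Finset.card_le_card hsub).trans Finset.card_biUnion_le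
          _ ≤ ∑ _i : Fin r, 2 * d := by
              refine Finset.sum_le_sum fun i _ => ?_
              have := Finset.card_union_le (E.filter fun e => e.1 = p.1 i)
                (E.filter fun e => e.2 = p.2 i)
              have h : (((E.filter fun e => e.1 = p.1 i) ∪
                (E.filter fun e => e.2 = p.2 i)).card : ℝ) ≤
                  (E.filter fun e => e.1 = p.1 i).card + (E.filter fun e => e.2 = p.2 i).card := by
                exact_mod_cast this
              linarith [hdX (p.1 i), hdY (p.2 i)]
          _ = r * (2 * d) := by simp
      have h2 : ((E \ free p).card : ℝ) + (free p).card = E.card := by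
        exact_mod_cast Finset.card_sdiff_add_card_eq_card (Finset.filter_subset _ _)
      linarith
    have hinj : ((ErSet E r).sigma free).card ≤ (ErSet E (r + 1)).card := by
      refine Finset.card_le_card_of_injOn
        (fun q => (Fin.cons q.2.1 q.1.1, Fin.cons q.2.2 q.1.2)) ?_ ?_
      · rintro ⟨p, e⟩ hq
        simp only [coe_sigma, Set.mem_sigma_iff, mem_coe, hfree, ErSet, mem_filter, mem_univ,
          true_and] at hq ⊢
        obtain ⟨⟨hpE, hp1, hp2⟩, heE, hne⟩ := hq
        refine ⟨fun i => ?_, ?_, ?_⟩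
        · refine Fin.cases ?_ (fun j => ?_) i
          · simpa using heE
          · simpa using hpE j
        · rw [Fin.cons_injective_iff]
          refine ⟨?_, hp1⟩
          rintro ⟨i, hi⟩
          exact (hne i).1 hi.symm
        · rw [Fin.cons_injective_iff]
          refine ⟨?_, hp2⟩
          rintro ⟨i, hi⟩
          exact (hne i).2 hi.symm
      · rintro ⟨⟨p1, p2⟩, ⟨e1, e2⟩⟩ _ ⟨⟨q1, q2⟩, ⟨f1, f2⟩⟩ _ h
        simp only [Prod.mk.injEq, Fin.cons_inj] at h
        obtain ⟨⟨rfl, rfl⟩, rfl, rfl⟩ := h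
        rfl
    calc c ^ (r + 1) = c ^ r * c := pow_succ _ _
      _ ≤ (ErSet E r).card * c := by gcongr
      _ = ∑ p ∈ ErSet E r, c := by simp
      _ ≤ ∑ p ∈ ErSet E r, ((free p).card : ℝ) := Finset.sum_le_sum fun p _ => hcount p
      _ = (((ErSet E r).sigma free).card : ℝ) := by
          rw [Finset.card_sigma]; push_cast; rfl
      _ ≤ _ := by exact_mod_cast hinj

theorem integral_Ico_ite_lt {s : ℝ} (h0 : 0 ≤ s) (h1 : s ≤ 1) :
    ∫ t in Set.Ico (0 : ℝ) 1, (if t < s then (1 : ℝ) else 0) = s := by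
  have h : (fun t : ℝ => if t < s then (1 : ℝ) else 0) = (Set.Iio s).indicator 1 := by
    ext t; simp [Set.indicator_apply]
  rw [h, MeasureTheory.integral_indicator_one measurableSet_Iio,
    MeasureTheory.measureReal_restrict_apply measurableSet_Iio]
  have h2 : Set.Iio s ∩ Set.Ico (0 : ℝ) 1 = Set.Ico 0 s := by
    ext t; simp only [Set.mem_inter_iff, Set.mem_Iio, Set.mem_Ico]
    constructor
    · rintro ⟨h, h', -⟩; exact ⟨h', h⟩
    · rintro ⟨h, h'⟩; exact ⟨h', h, by linarith⟩
  rw [h2]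
  simp [h0]

theorem integrable_Ico_ite_lt (s : ℝ) :
    MeasureTheory.IntegrableOn (fun t : ℝ => if t < s then (1 : ℝ) else 0) (Set.Ico (0 : ℝ) 1) := by
  have h : (fun t : ℝ => if t < s then (1 : ℝ) else 0) = (Set.Iio s).indicator 1 := by
    ext t; simp [Set.indicator_apply]
  rw [h]
  refine MeasureTheory.IntegrableOn.indicator ?_ measurableSet_Iio
  exact MeasureTheory.integrableOn_const (C := (1 : ℝ)) (by simp)

/-- A linear inequality between threshold indicators that holds at every level holds between
the thresholds. -/
theorem sum_threshold_le {ι : Type*} (E : Finset ι) (α β m M : ι → ℝ)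
    (hm : ∀ e ∈ E, 0 ≤ m e ∧ m e ≤ 1) (hM : ∀ e ∈ E, 0 ≤ M e ∧ M e ≤ 1)
    (h : ∀ t : ℝ, 0 ≤ t → ∑ e ∈ E, α e * (if t < m e then (1 : ℝ) else 0) ≤
      ∑ e ∈ E, β e * (if t < M e then (1 : ℝ) else 0)) :
    ∑ e ∈ E, α e * m e ≤ ∑ e ∈ E, β e * M e := by
  have key : ∀ γ s : ι → ℝ, (∀ e ∈ E, 0 ≤ s e ∧ s e ≤ 1) →
      ∫ t in Set.Ico (0 : ℝ) 1, ∑ e ∈ E, γ e * (if t < s e then (1 : ℝ) else 0) =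
        ∑ e ∈ E, γ e * s e := by
    intro γ s hs
    rw [MeasureTheory.integral_finsetSum _ fun e _ => (integrable_Ico_ite_lt _).const_mul _]
    refine Finset.sum_congr rfl fun e he => ?_
    rw [MeasureTheory.integral_const_mul, integral_Ico_ite_lt (hs e he).1 (hs e he).2]
  rw [← key α m hm, ← key β M hM]
  refine MeasureTheory.setIntegral_mono_on ?_ ?_ measurableSet_Ico fun t ht => h t ht.1
  · exact MeasureTheory.integrable_finsetSum _ fun e _ => (integrable_Ico_ite_lt _).const_mul _
  · exact MeasureTheory.integrable_finsetSum _ fun e _ => (integrable_Ico_ite_lt _).const_mul _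

/-- Correlated sampling: players sharing randomness pick `ω` according to close distributions
`p x` and `q y`, and then answer according to `a x ω` and `b y ω`. -/
theorem exists_strategy_of_distributions {X Y A B Ω : Type*} [Fintype X] [Fintype Y] [Fintype A]
    [Fintype B] [Nonempty A] [Nonempty B] [Fintype Ω] (E : Finset (X × Y))
    (R : X → Y → A → B → Prop) (p : X → Ω → ℝ) (q : Y → Ω → ℝ) (hp0 : ∀ x ω, 0 ≤ p x ω)
    (hq0 : ∀ y ω, 0 ≤ q y ω) (hq1 : ∀ y ω, q y ω ≤ 1) (hp : ∀ x, ∑ ω, p x ω = 1)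
    (a : X → Ω → A) (b : Y → Ω → B) :
    ∃ (φ : X → A) (ψ : Y → B),
      ∑ e ∈ E, (if R e.1 e.2 (φ e.1) (ψ e.2) then (0 : ℝ) else 1) ≤
        ∑ e ∈ E, ∑ ω, (|p e.1 ω - q e.2 ω| +
          p e.1 ω * (if R e.1 e.2 (a e.1 ω) (b e.2 ω) then (0 : ℝ) else 1)) := by
  have hp1 : ∀ x ω, p x ω ≤ 1 := fun x ω => by
    rw [← hp x]; exact Finset.single_le_sum (fun ω _ => hp0 x ω) (mem_univ ω)
  set u : X × Y → ℝ := fun e => ∑ ω, max (p e.1 ω) (q e.2 ω) with hu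
  have hu1 : ∀ e, 1 ≤ u e := fun e => by
    rw [← hp e.1]; exact Finset.sum_le_sum fun ω _ => le_max_left _ _
  set sat : (X → A) × (Y → B) → X × Y → ℝ := fun φ e =>
    if R e.1 e.2 (φ.1 e.1) (φ.2 e.2) then 1 else 0 with hsat
  have hsat0 : ∀ φ e, 0 ≤ sat φ e := fun φ e => by simp only [hsat]; positivity
  obtain ⟨φ, -, hφ⟩ := Finset.exists_max_image (univ : Finset ((X → A) × (Y → B)))
    (fun φ => ∑ e ∈ E, (u e)⁻¹ * sat φ e) Finset.univ_nonempty
  have hω : ∀ ω, ∑ e ∈ E, (u e)⁻¹ * sat (fun x => a x ω, fun y => b y ω) e *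
      min (p e.1 ω) (q e.2 ω) ≤ ∑ e ∈ E, (u e)⁻¹ * sat φ e * max (p e.1 ω) (q e.2 ω) := by
    intro ω
    refine sum_threshold_le E _ _ _ _ (fun e _ => ⟨le_min (hp0 _ _) (hq0 _ _),
      (min_le_left _ _).trans (hp1 _ _)⟩) (fun e _ => ⟨(hp0 _ _).trans (le_max_left _ _),
      max_le (hp1 _ _) (hq1 _ _)⟩) fun t _ => ?_
    have h := hφ (fun x => if t < p x ω then a x ω else φ.1 x,
      fun y => if t < q y ω then b y ω else φ.2 y) (mem_univ _)
    have h2 : ∑ e ∈ E, ((u e)⁻¹ * sat (fun x => a x ω, fun y => b y ω) e *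
          (if t < min (p e.1 ω) (q e.2 ω) then (1 : ℝ) else 0) + ((u e)⁻¹ * sat φ e -
          (u e)⁻¹ * sat φ e * (if t < max (p e.1 ω) (q e.2 ω) then (1 : ℝ) else 0))) ≤
        ∑ e ∈ E, (u e)⁻¹ * sat (fun x => if t < p x ω then a x ω else φ.1 x,
          fun y => if t < q y ω then b y ω else φ.2 y) e := by
      refine Finset.sum_le_sum fun e _ => ?_
      have hui : 0 ≤ (u e)⁻¹ := inv_nonneg.2 (zero_le_one.trans (hu1 e))
      have key : sat (fun x => a x ω, fun y => b y ω) e *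
          (if t < min (p e.1 ω) (q e.2 ω) then (1 : ℝ) else 0) + (sat φ e -
          sat φ e * (if t < max (p e.1 ω) (q e.2 ω) then (1 : ℝ) else 0)) ≤
          sat (fun x => if t < p x ω then a x ω else φ.1 x,
          fun y => if t < q y ω then b y ω else φ.2 y) e := by
        have hnn := hsat0 (fun x => if t < p x ω then a x ω else φ.1 x,
          fun y => if t < q y ω then b y ω else φ.2 y) e
        by_cases h3 : t < p e.1 ω <;> by_cases h4 : t < q e.2 ω
        · simp [hsat, h3, h4]
        · simpa [h3, h4] using hnn
        · simpa [h3, h4] using hnn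
        · simp [hsat, h3, h4]
      calc _ = (u e)⁻¹ * (sat (fun x => a x ω, fun y => b y ω) e *
          (if t < min (p e.1 ω) (q e.2 ω) then (1 : ℝ) else 0) + (sat φ e -
          sat φ e * (if t < max (p e.1 ω) (q e.2 ω) then (1 : ℝ) else 0))) := by ring
        _ ≤ _ := mul_le_mul_of_nonneg_left key hui
    rw [Finset.sum_add_distrib, Finset.sum_sub_distrib] at h2
    linarith
  have hsum := Finset.sum_le_sum fun ω (_ : ω ∈ (univ : Finset Ω)) => hω ω
  rw [Finset.sum_comm, Finset.sum_comm (s := univ)] at hsum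
  have hR : ∑ e ∈ E, ∑ ω, (u e)⁻¹ * sat φ e * max (p e.1 ω) (q e.2 ω) = ∑ e ∈ E, sat φ e := by
    refine Finset.sum_congr rfl fun e _ => ?_
    rw [← Finset.mul_sum]
    change (u e)⁻¹ * sat φ e * u e = _
    have := hu1 e
    field_simp
  rw [hR] at hsum
  refine ⟨φ.1, φ.2, ?_⟩
  have h5 : ∑ e ∈ E, (if R e.1 e.2 (φ.1 e.1) (φ.2 e.2) then (0 : ℝ) else 1) =
      ∑ e ∈ E, (1 - sat φ e) := by
    refine Finset.sum_congr rfl fun e _ => ?_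
    simp only [hsat]
    split_ifs <;> simp
  have h6 : ∑ e ∈ E, (1 - ∑ ω, (u e)⁻¹ * sat (fun x => a x ω, fun y => b y ω) e *
      min (p e.1 ω) (q e.2 ω)) ≤ ∑ e ∈ E, ∑ ω, (|p e.1 ω - q e.2 ω| +
          p e.1 ω * (if R e.1 e.2 (a e.1 ω) (b e.2 ω) then (0 : ℝ) else 1)) := by
    refine Finset.sum_le_sum fun e _ => ?_
    have hu0 : 0 < u e := zero_lt_one.trans_le (hu1 e)
    set W : ℝ := ∑ ω, (max (p e.1 ω) (q e.2 ω) - sat (fun x => a x ω, fun y => b y ω) e *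
      min (p e.1 ω) (q e.2 ω)) with hW
    have hsle : ∀ φ, sat φ e ≤ 1 := fun φ => by
      simp only [hsat]; split_ifs <;> simp
    have hW0 : 0 ≤ W := by
      refine Finset.sum_nonneg fun ω _ => ?_
      have h7 : 0 ≤ min (p e.1 ω) (q e.2 ω) := le_min (hp0 _ _) (hq0 _ _)
      have h8 : min (p e.1 ω) (q e.2 ω) ≤ max (p e.1 ω) (q e.2 ω) := min_le_max
      nlinarith [hsle (fun x => a x ω, fun y => b y ω)]
    have h9 : 1 - ∑ ω, (u e)⁻¹ * sat (fun x => a x ω, fun y => b y ω) e *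
        min (p e.1 ω) (q e.2 ω) = (u e)⁻¹ * W := by
      rw [hW, Finset.sum_sub_distrib]
      change _ = (u e)⁻¹ * (u e - _)
      rw [mul_sub, inv_mul_cancel₀ hu0.ne', Finset.mul_sum]
      simp only [mul_assoc]
    rw [h9]
    calc (u e)⁻¹ * W ≤ 1 * W := by
          gcongr
          exact inv_le_one_of_one_le₀ (hu1 e)
      _ = W := one_mul _
      _ ≤ _ := by
          refine Finset.sum_le_sum fun ω _ => ?_
          have h10 := max_sub_min_eq_abs' (p e.1 ω) (q e.2 ω)
          have h11 : min (p e.1 ω) (q e.2 ω) ≤ p e.1 ω := min_le_left _ _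
          simp only [hsat]
          split_ifs
          · linarith
          · have := le_min (hp0 e.1 ω) (hq0 e.2 ω)
            linarith
  rw [h5]
  refine le_trans ?_ h6
  rw [Finset.sum_sub_distrib, Finset.sum_sub_distrib]
  linarith

/-- The average of `h` over the edges of `E` ending in `y`. -/
def nbrAvg {X Y : Type*} (E : Finset (X × Y)) (h : X × Y → ℝ) (y : Y) : ℝ :=
  ((E.filter fun e => e.2 = y).card : ℝ)⁻¹ * ∑ e ∈ E.filter (fun e => e.2 = y), h e

theorem sum_mul_nbrAvg {X Y : Type*} [Fintype Y] (E : Finset (X × Y)) (h : X × Y → ℝ)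
    (φ : Y → ℝ) :
    ∑ e ∈ E, φ e.2 * nbrAvg E h e.2 = ∑ e ∈ E, φ e.2 * h e := by
  rw [← Finset.sum_fiberwise E (fun e => e.2), ← Finset.sum_fiberwise E (fun e => e.2)]
  refine Finset.sum_congr rfl fun y _ => ?_
  have hl : ∑ e ∈ E.filter (fun e => e.2 = y), φ e.2 * nbrAvg E h e.2 =
      (E.filter fun e => e.2 = y).card * (φ y * nbrAvg E h y) := by
    rw [← nsmul_eq_mul, ← Finset.sum_const]
    exact Finset.sum_congr rfl fun e he => by rw [(mem_filter.1 he).2]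
  have hr : ∑ e ∈ E.filter (fun e => e.2 = y), φ e.2 * h e =
      φ y * ∑ e ∈ E.filter (fun e => e.2 = y), h e := by
    rw [Finset.mul_sum]
    exact Finset.sum_congr rfl fun e he => by rw [(mem_filter.1 he).2]
  rw [hl, hr, nbrAvg]
  by_cases hc : (E.filter fun e => e.2 = y).card = 0
  · rw [Finset.card_eq_zero.1 hc]; simp
  · have : ((E.filter fun e => e.2 = y).card : ℝ) ≠ 0 := by exact_mod_cast hc
    field_simp

theorem nbrAvg_nonneg {X Y : Type*} (E : Finset (X × Y)) {h : X × Y → ℝ} (hh : ∀ e, 0 ≤ h e)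
    (y : Y) : 0 ≤ nbrAvg E h y :=
  mul_nonneg (by positivity) (Finset.sum_nonneg fun e _ => hh e)

theorem sum_nbrAvg {X Y B : Type*} [Fintype B] (E : Finset (X × Y)) (h : B → X × Y → ℝ) (y : Y) :
    ∑ b, nbrAvg E (h b) y = nbrAvg E (fun e => ∑ b, h b e) y := by
  simp only [nbrAvg]
  rw [← Finset.mul_sum, Finset.sum_comm]

theorem le_of_rounding_loss {ε m V A P₁ P₂ P₃ : ℝ} (hε : 0 ≤ ε) (hm : 0 ≤ m) (hV0 : 0 ≤ V)
    (hA : 0 ≤ m - A) (hVA : V ≤ A) (hP₁ : P₁ ^ 2 ≤ (m - A) * (m + 3 * A))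
    (hP₃ : P₃ ^ 2 ≤ (m - A) * m) (hP₂ : V - P₃ ≤ P₂) (h : ε * m ≤ P₁ + (m - P₂)) :
    V ≤ (1 - ε ^ 2 / 16) * m := by
  set D : ℝ := m - V with hDdef
  have hDD : 0 ≤ D := by linarith
  set s : ℝ := Real.sqrt (m * D) with hs
  have hs2 : s ^ 2 = m * D := Real.sq_sqrt (mul_nonneg hm hDD)
  have hs0 : 0 ≤ s := Real.sqrt_nonneg _
  have hAD : (m - A) * m ≤ m * D := by
    rw [mul_comm]
    exact mul_le_mul_of_nonneg_left (by linarith) hm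
  have e1 : P₁ ≤ 2 * s := by
    refine (abs_le_of_sq_le_sq' ?_ (by positivity)).2
    have : (m - A) * (m + 3 * A) ≤ (m - A) * (4 * m) :=
      mul_le_mul_of_nonneg_left (by linarith) hA
    nlinarith
  have e2 : P₃ ≤ s := (abs_le_of_sq_le_sq' (by linarith) hs0).2
  have e3 : D ≤ s := by
    refine (abs_le_of_sq_le_sq' ?_ hs0).2
    rw [hs2, sq]
    exact mul_le_mul_of_nonneg_right (by linarith) hDD
  have e4 : ε * m ≤ 4 * s := by linarith
  have e5 : (ε * m) ^ 2 ≤ 16 * (m * D) := by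
    rw [← hs2]
    have := pow_le_pow_left₀ (mul_nonneg hε hm) e4 2
    linarith [mul_pow 4 s 2]
  rcases hm.eq_or_lt with h0 | hpos
  · rw [← h0] at hDdef ⊢
    linarith
  · have : ε ^ 2 * m ≤ 16 * D := by
      refine le_of_mul_le_mul_left ?_ hpos
      nlinarith
    linarith

/-- A weighted family of answers that a projection game nearly preserves in the `ℓ²` sense can be
rounded to a good strategy; contrapositively, the loss of the family is at least quadratic in
the failure probability `ε` of the game. -/
theorem sum_sq_nbrAvg_le {X Y A B Ω : Type*} [Fintype X] [Fintype Y] [Fintype A]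
    [Fintype B] [Nonempty A] [Nonempty B] [Fintype Ω] (E : Finset (X × Y))
    (π : X → Y → A → B) {ε : ℝ} (hε : 0 ≤ ε)
    (hval : ∀ (φ : X → A) (ψ : Y → B),
      ε * E.card ≤ ∑ e ∈ E, (if π e.1 e.2 (φ e.1) = ψ e.2 then (0 : ℝ) else 1))
    (f : X → A → Ω → ℝ) (hf : ∀ x a ω, 0 ≤ f x a ω)
    (hf1 : ∀ x, ∑ ω, (∑ a, f x a ω) ^ 2 = 1) :
    ∑ e ∈ E, ∑ ω, ∑ b,
        (nbrAvg E (fun e => ∑ a, if π e.1 e.2 a = b then f e.1 a ω else 0) e.2) ^ 2 ≤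
      (1 - ε ^ 2 / 16) * E.card := by
  set F : X → Ω → ℝ := fun x ω => ∑ a, f x a ω with hF
  set H : X × Y → B → Ω → ℝ := fun e b ω => ∑ a, if π e.1 e.2 a = b then f e.1 a ω else 0 with hH
  set g : Y → B → Ω → ℝ := fun y b ω => nbrAvg E (fun e => H e b ω) y with hg
  set Fb : Y → Ω → ℝ := fun y ω => nbrAvg E (fun e => F e.1 ω) y with hFb
  set m : ℝ := (E.card : ℝ) with hm
  change ∑ e ∈ E, ∑ ω, ∑ b, (g e.2 b ω) ^ 2 ≤ _
  set V : ℝ := ∑ e ∈ E, ∑ ω, ∑ b, (g e.2 b ω) ^ 2 with hV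
  have hF0 : ∀ x ω, 0 ≤ F x ω := fun x ω => Finset.sum_nonneg fun a _ => hf x a ω
  have hH0 : ∀ e b ω, 0 ≤ H e b ω := fun e b ω => Finset.sum_nonneg fun a _ => by
    split_ifs
    exacts [hf _ _ _, le_rfl]
  have hHsum : ∀ e ω, ∑ b, H e b ω = F e.1 ω := fun e ω => by
    simp only [hH, hF]
    rw [Finset.sum_comm]
    simp
  have hHF : ∀ e b ω, H e b ω ≤ F e.1 ω := fun e b ω => by
    rw [← hHsum]; exact Finset.single_le_sum (fun b _ => hH0 e b ω) (mem_univ b)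
  have hg0 : ∀ y b ω, 0 ≤ g y b ω := fun y b ω => nbrAvg_nonneg E (fun e => hH0 e b ω) y
  have hFb0 : ∀ y ω, 0 ≤ Fb y ω := fun y ω => nbrAvg_nonneg E (fun e => hF0 e.1 ω) y
  have hgsum : ∀ y ω, ∑ b, g y b ω = Fb y ω := fun y ω => by
    simp only [hg, hFb]
    rw [sum_nbrAvg E (fun b e => H e b ω)]
    simp only [hHsum]
  have hgF : ∀ y b ω, g y b ω ≤ Fb y ω := fun y b ω => by
    rw [← hgsum]; exact Finset.single_le_sum (fun b _ => hg0 y b ω) (mem_univ b)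
  have hbs : ∀ y ω, ∃ b₀, ∀ b, g y b ω ≤ g y b₀ ω := fun y ω => by
    obtain ⟨b₀, -, h⟩ := Finset.exists_max_image univ (fun b => g y b ω) univ_nonempty
    exact ⟨b₀, fun b => h b (mem_univ b)⟩
  choose bs hbs using hbs
  have hm1 : ∑ e ∈ E, ∑ ω, F e.1 ω ^ 2 = m := by simp [hf1, hF, hm]
  have hgg : ∀ y ω, ∑ b, g y b ω ^ 2 ≤ Fb y ω * g y (bs y ω) ω := fun y ω => by
    rw [← hgsum, Finset.sum_mul]
    refine Finset.sum_le_sum fun b _ => ?_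
    rw [sq]
    exact mul_le_mul_of_nonneg_left (hbs y ω b) (hg0 y b ω)
  have h1 : V ≤ ∑ e ∈ E, ∑ ω, Fb e.2 ω * H e (bs e.2 ω) ω := by
    calc V ≤ ∑ e ∈ E, ∑ ω, Fb e.2 ω * g e.2 (bs e.2 ω) ω :=
          Finset.sum_le_sum fun e _ => Finset.sum_le_sum fun ω _ => hgg e.2 ω
      _ = _ := by
          rw [Finset.sum_comm, Finset.sum_comm (s := E)]
          refine Finset.sum_congr rfl fun ω _ => ?_
          rw [← sum_mul_nbrAvg E (fun e => H e (bs e.2 ω) ω) (fun y => Fb y ω)]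
          refine Finset.sum_congr rfl fun e _ => ?_
          congr 1
          simp only [hg, nbrAvg]
          congr 1
          exact Finset.sum_congr rfl fun e' he' => by rw [(mem_filter.1 he').2]
  set A₂ : ℝ := ∑ e ∈ E, ∑ ω, Fb e.2 ω ^ 2 with hA₂
  have h2 : V ≤ A₂ := Finset.sum_le_sum fun e _ => Finset.sum_le_sum fun ω _ =>
    (hgg e.2 ω).trans (by rw [sq]; exact mul_le_mul_of_nonneg_left (hgF _ _ _) (hFb0 _ _))
  have h3 : ∑ e ∈ E, ∑ ω, Fb e.2 ω * F e.1 ω = A₂ := by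
    rw [hA₂, Finset.sum_comm, Finset.sum_comm (s := E)]
    refine Finset.sum_congr rfl fun ω _ => ?_
    rw [← sum_mul_nbrAvg E (fun e => F e.1 ω) (fun y => Fb y ω)]
    exact Finset.sum_congr rfl fun e _ => by rw [sq]
  have hD : ∑ e ∈ E, ∑ ω, (F e.1 ω - Fb e.2 ω) ^ 2 = m - A₂ := by
    have : ∀ (e : X × Y) ω, (F e.1 ω - Fb e.2 ω) ^ 2 =
        F e.1 ω ^ 2 - 2 * (Fb e.2 ω * F e.1 ω) + Fb e.2 ω ^ 2 := fun e ω => by ring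
    simp only [this, Finset.sum_add_distrib, Finset.sum_sub_distrib, ← Finset.mul_sum]
    rw [h3, hm1]; ring
  have hS : ∑ e ∈ E, ∑ ω, (F e.1 ω + Fb e.2 ω) ^ 2 = m + 3 * A₂ := by
    have : ∀ (e : X × Y) ω, (F e.1 ω + Fb e.2 ω) ^ 2 =
        F e.1 ω ^ 2 + 2 * (Fb e.2 ω * F e.1 ω) + Fb e.2 ω ^ 2 := fun e ω => by ring
    simp only [this, Finset.sum_add_distrib, ← Finset.mul_sum]
    rw [h3, hm1]; ring
  have hD0 : 0 ≤ m - A₂ := by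
    rw [← hD]; exact Finset.sum_nonneg fun e _ => Finset.sum_nonneg fun ω _ => sq_nonneg _
  have cs : ∀ u v : X × Y → Ω → ℝ, (∑ e ∈ E, ∑ ω, u e ω * v e ω) ^ 2 ≤
      (∑ e ∈ E, ∑ ω, u e ω ^ 2) * ∑ e ∈ E, ∑ ω, v e ω ^ 2 := by
    intro u v
    have := Finset.sum_mul_sq_le_sq_mul_sq (E ×ˢ (univ : Finset Ω)) (fun z => u z.1 z.2)
      (fun z => v z.1 z.2)
    simpa only [Finset.sum_product] using this
  set P₁ : ℝ := ∑ e ∈ E, ∑ ω, |F e.1 ω ^ 2 - Fb e.2 ω ^ 2| with hP₁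
  have hP₁' : P₁ ^ 2 ≤ (m - A₂) * (m + 3 * A₂) := by
    have h := cs (fun e ω => |F e.1 ω - Fb e.2 ω|) (fun e ω => F e.1 ω + Fb e.2 ω)
    simp only [sq_abs] at h
    rw [hD, hS] at h
    refine le_trans (le_of_eq ?_) h
    congr 1
    refine Finset.sum_congr rfl fun e _ => Finset.sum_congr rfl fun ω _ => ?_
    rw [← abs_of_nonneg (add_nonneg (hF0 e.1 ω) (hFb0 e.2 ω)), ← abs_mul]
    congr 1
    ring
  set P₃ : ℝ := ∑ e ∈ E, ∑ ω, |F e.1 ω - Fb e.2 ω| * H e (bs e.2 ω) ω with hP₃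
  have hP₃' : P₃ ^ 2 ≤ (m - A₂) * m := by
    have h := cs (fun e ω => |F e.1 ω - Fb e.2 ω|) (fun e ω => H e (bs e.2 ω) ω)
    simp only [sq_abs] at h
    rw [hD] at h
    refine h.trans (mul_le_mul_of_nonneg_left ?_ hD0)
    rw [← hm1]
    exact Finset.sum_le_sum fun e _ => Finset.sum_le_sum fun ω _ =>
      pow_le_pow_left₀ (hH0 _ _ _) (hHF _ _ _) 2
  set P₂ : ℝ := ∑ e ∈ E, ∑ ω, F e.1 ω * H e (bs e.2 ω) ω with hP₂
  have hP₂' : V - P₃ ≤ P₂ := by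
    have : ∑ e ∈ E, ∑ ω, Fb e.2 ω * H e (bs e.2 ω) ω ≤ P₂ + P₃ := by
      rw [hP₂, hP₃, ← Finset.sum_add_distrib]
      refine Finset.sum_le_sum fun e _ => ?_
      rw [← Finset.sum_add_distrib]
      refine Finset.sum_le_sum fun ω _ => ?_
      rw [← add_mul]
      refine mul_le_mul_of_nonneg_right ?_ (hH0 _ _ _)
      linarith [neg_le_abs (F e.1 ω - Fb e.2 ω)]
    linarith
  have hch : ∀ x ω, ∃ a, F x ω * ∑ e ∈ E.filter (fun e => e.1 = x),
        (if π e.1 e.2 a = bs e.2 ω then (0 : ℝ) else 1) ≤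
      ∑ a', f x a' ω * ∑ e ∈ E.filter (fun e => e.1 = x),
        (if π e.1 e.2 a' = bs e.2 ω then (0 : ℝ) else 1) := by
    intro x ω
    obtain ⟨a, -, ha⟩ := Finset.exists_min_image univ (fun a => ∑ e ∈ E.filter (fun e => e.1 = x),
        (if π e.1 e.2 a = bs e.2 ω then (0 : ℝ) else 1)) univ_nonempty
    refine ⟨a, ?_⟩
    rw [hF, Finset.sum_mul]
    exact Finset.sum_le_sum fun a' _ => mul_le_mul_of_nonneg_left (ha a' (mem_univ _)) (hf _ _ _)
  choose as has using hch
  have hq1 : ∀ y ω, Fb y ω ^ 2 ≤ 1 := by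
    intro y ω
    have hF1 : ∀ x, F x ω ≤ 1 := fun x => by
      have h : F x ω ^ 2 ≤ 1 := by
        rw [← hf1 x]
        exact Finset.single_le_sum (f := fun ω => F x ω ^ 2) (fun ω _ => sq_nonneg _) (mem_univ ω)
      exact (sq_le_one_iff₀ (hF0 x ω)).1 h
    refine (sq_le_one_iff₀ (hFb0 y ω)).2 ?_
    simp only [hFb, nbrAvg]
    by_cases hc : (E.filter fun e => e.2 = y).card = 0
    · rw [hc]; simp
    · have hc' : (0 : ℝ) < (E.filter fun e => e.2 = y).card := by
        exact_mod_cast Nat.pos_of_ne_zero hc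
      rw [inv_mul_le_iff₀ hc', mul_one]
      calc _ ≤ ∑ e ∈ E.filter (fun e => e.2 = y), (1 : ℝ) := Finset.sum_le_sum fun e _ => hF1 e.1
        _ = _ := by simp
  obtain ⟨φ, ψ, hφψ⟩ := exists_strategy_of_distributions E (fun x y a b => π x y a = b)
    (fun x ω => F x ω ^ 2) (fun y ω => Fb y ω ^ 2) (fun _ _ => sq_nonneg _) (fun _ _ => sq_nonneg _)
    hq1 hf1 as bs
  have hmain := (hval φ ψ).trans hφψ
  simp only [Finset.sum_add_distrib] at hmain
  have hlast : ∑ e ∈ E, ∑ ω, F e.1 ω ^ 2 *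
      (if π e.1 e.2 (as e.1 ω) = bs e.2 ω then (0 : ℝ) else 1) ≤ m - P₂ := by
    calc _ = ∑ ω, ∑ x, F x ω * (F x ω * ∑ e ∈ E.filter (fun e => e.1 = x),
          (if π e.1 e.2 (as x ω) = bs e.2 ω then (0 : ℝ) else 1)) := by
          rw [Finset.sum_comm]
          refine Finset.sum_congr rfl fun ω _ => ?_
          rw [← Finset.sum_fiberwise E (fun e => e.1)]
          refine Finset.sum_congr rfl fun x _ => ?_
          rw [← mul_assoc, ← sq, Finset.mul_sum]
          exact Finset.sum_congr rfl fun e he => by rw [(mem_filter.1 he).2]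
      _ ≤ ∑ ω, ∑ x, F x ω * ∑ a', f x a' ω * ∑ e ∈ E.filter (fun e => e.1 = x),
          (if π e.1 e.2 a' = bs e.2 ω then (0 : ℝ) else 1) :=
          Finset.sum_le_sum fun ω _ => Finset.sum_le_sum fun x _ =>
            mul_le_mul_of_nonneg_left (has x ω) (hF0 x ω)
      _ = ∑ ω, ∑ e ∈ E, (F e.1 ω ^ 2 - F e.1 ω * H e (bs e.2 ω) ω) := by
          refine Finset.sum_congr rfl fun ω _ => ?_
          rw [← Finset.sum_fiberwise E (fun e => e.1)]
          refine Finset.sum_congr rfl fun x _ => ?_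
          simp only [Finset.mul_sum]
          rw [Finset.sum_comm]
          refine Finset.sum_congr rfl fun e he => ?_
          rw [← (mem_filter.1 he).2, sq, ← mul_sub]
          rw [← Finset.mul_sum]
          congr 1
          simp only [hF, hH]
          rw [← Finset.sum_sub_distrib]
          refine Finset.sum_congr rfl fun a _ => ?_
          split_ifs <;> simp
      _ = m - P₂ := by
          rw [Finset.sum_comm]
          simp only [Finset.sum_sub_distrib]
          rw [hm1]
  exact le_of_rounding_loss hε (Nat.cast_nonneg _) (Finset.sum_nonneg fun e _ =>
    Finset.sum_nonneg fun ω _ => Finset.sum_nonneg fun b _ => sq_nonneg _) hD0 h2 hP₁' hP₃' hP₂'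
    (by linarith)

theorem nbrAvg_mul_right {X Y : Type*} (E : Finset (X × Y)) (h : X × Y → ℝ) (c : ℝ) (y : Y) :
    nbrAvg E (fun e => h e * c) y = nbrAvg E h y * c := by
  simp only [nbrAvg]
  rw [← Finset.sum_mul, mul_assoc]

theorem sum_sq_nbrAvg_le_mul {X Y A B Ω : Type*} [Fintype X] [Fintype Y] [Fintype A]
    [Fintype B] [Nonempty A] [Nonempty B] [Fintype Ω] (E : Finset (X × Y))
    (π : X → Y → A → B) {ε : ℝ} (hε : 0 ≤ ε)
    (hval : ∀ (φ : X → A) (ψ : Y → B),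
      ε * E.card ≤ ∑ e ∈ E, (if π e.1 e.2 (φ e.1) = ψ e.2 then (0 : ℝ) else 1))
    (f : X → A → Ω → ℝ) (hf : ∀ x a ω, 0 ≤ f x a ω) {θ : ℝ} (hθ : 0 < θ)
    (hf1 : ∀ x, ∑ ω, (∑ a, f x a ω) ^ 2 ≤ θ) :
    ∑ e ∈ E, ∑ ω, ∑ b,
        (nbrAvg E (fun e => ∑ a, if π e.1 e.2 a = b then f e.1 a ω else 0) e.2) ^ 2 ≤
      (1 - ε ^ 2 / 16) * E.card * θ := by
  obtain ⟨a₀⟩ := ‹Nonempty A›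
  have hA : Nonempty A := ⟨a₀⟩
  have hr : 0 < √θ := Real.sqrt_pos.2 hθ
  have hr2 : √θ ^ 2 = θ := Real.sq_sqrt hθ.le
  set f' : X → A → Option Ω → ℝ := fun x a o =>
    o.elim (if a = a₀ then √(1 - (∑ ω, (∑ a, f x a ω) ^ 2) / θ) else 0)
      (fun ω => f x a ω * (√θ)⁻¹) with hf'
  have h := sum_sq_nbrAvg_le E π hε hval f' ?_ ?_
  · simp only [Fintype.sum_option, Finset.sum_add_distrib] at h
    have h0 : 0 ≤ ∑ e ∈ E, ∑ b, (nbrAvg E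
        (fun e => ∑ a, if π e.1 e.2 a = b then f' e.1 a none else 0) e.2) ^ 2 :=
      Finset.sum_nonneg fun e _ => Finset.sum_nonneg fun b _ => sq_nonneg _
    have h1 : ∑ e ∈ E, ∑ ω, ∑ b,
        (nbrAvg E (fun e => ∑ a, if π e.1 e.2 a = b then f' e.1 a (some ω) else 0) e.2) ^ 2 =
        (∑ e ∈ E, ∑ ω, ∑ b,
        (nbrAvg E (fun e => ∑ a, if π e.1 e.2 a = b then f e.1 a ω else 0) e.2) ^ 2) * θ⁻¹ := by
      simp only [Finset.sum_mul]
      refine Finset.sum_congr rfl fun e _ => Finset.sum_congr rfl fun ω _ =>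
        Finset.sum_congr rfl fun b _ => ?_
      have : θ⁻¹ = ((√θ)⁻¹) ^ 2 := by rw [inv_pow, hr2]
      rw [this, ← mul_pow, ← nbrAvg_mul_right]
      simp only [hf', Option.elim, Finset.sum_mul, ite_mul, zero_mul]
    rw [h1] at h
    rw [← div_le_iff₀ hθ, div_eq_mul_inv]
    linarith
  · rintro x a (_ | ω)
    · simp only [hf', Option.elim]
      split_ifs
      exacts [Real.sqrt_nonneg _, le_rfl]
    · exact mul_nonneg (hf x a ω) (inv_nonneg.2 hr.le)
  · intro x
    have : (∑ ω, (∑ a, f x a ω) ^ 2) / θ ≤ 1 := by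
      rw [div_le_one hθ]; exact hf1 x
    simp only [hf', Fintype.sum_option, Option.elim, Finset.sum_ite_eq', mem_univ, if_true]
    rw [Real.sq_sqrt (by linarith)]
    simp only [← Finset.sum_mul, mul_pow, inv_pow, hr2]
    rw [div_eq_mul_inv]
    ring

/-- The normalised constraint kernel of a projection game. -/
def projKernel {X Y A B : Type*} (E : Finset (X × Y)) (π : X → Y → A → B) (i : Y × B) (x : X)
    (a : A) : ℝ :=
  if (x, i.1) ∈ E ∧ π x i.1 a = i.2 then
    (√(E.card * (E.filter fun e => e.2 = i.1).card))⁻¹ else 0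

theorem projKernel_nonneg {X Y A B : Type*} (E : Finset (X × Y)) (π : X → Y → A → B) (i : Y × B)
    (x : X) (a : A) : 0 ≤ projKernel E π i x a := by
  unfold projKernel
  split_ifs
  exacts [inv_nonneg.2 (Real.sqrt_nonneg _), le_rfl]

theorem sum_filter_snd_eq {X Y : Type*} [Fintype X] (E : Finset (X × Y)) (y : Y)
    (h : X × Y → ℝ) :
    ∑ e ∈ E.filter (fun e => e.2 = y), h e = ∑ x, if (x, y) ∈ E then h (x, y) else 0 := by
  rw [← Finset.sum_filter]
  refine Finset.sum_nbij' (fun e => e.1) (fun x => (x, y)) ?_ ?_ ?_ ?_ ?_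
  · rintro ⟨x, z⟩ he
    obtain ⟨hmem, rfl⟩ := mem_filter.1 he
    exact mem_filter.2 ⟨mem_univ _, hmem⟩
  · intro x hx
    exact mem_filter.2 ⟨(mem_filter.1 hx).2, rfl⟩
  · rintro ⟨x, z⟩ he
    obtain ⟨he, rfl⟩ := mem_filter.1 he
    rfl
  · intro x _
    rfl
  · rintro ⟨x, z⟩ he
    obtain ⟨he, rfl⟩ := mem_filter.1 he
    rfl

theorem sum_snd_eq_sum_card_mul {X Y : Type*} [Fintype Y] (E : Finset (X × Y)) (φ : Y → ℝ) :
    ∑ e ∈ E, φ e.2 = ∑ y, ((E.filter fun e => e.2 = y).card : ℝ) * φ y := by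
  rw [← Finset.sum_fiberwise E (fun e => e.2)]
  refine Finset.sum_congr rfl fun y _ => ?_
  rw [← nsmul_eq_mul, ← Finset.sum_const]
  exact Finset.sum_congr rfl fun e he => by rw [(mem_filter.1 he).2]

theorem sum_sq_projKernel_le {X Y A B Ω : Type*} [Fintype X] [Fintype Y] [Fintype A]
    [Fintype B] [Nonempty A] [Nonempty B] [Fintype Ω] (E : Finset (X × Y)) (hE : E.Nonempty)
    (π : X → Y → A → B) {ε : ℝ} (hε : 0 ≤ ε)
    (hval : ∀ (φ : X → A) (ψ : Y → B),
      ε * E.card ≤ ∑ e ∈ E, (if π e.1 e.2 (φ e.1) = ψ e.2 then (0 : ℝ) else 1))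
    (f : X → A → Ω → ℝ) (hf : ∀ x a ω, 0 ≤ f x a ω) {θ : ℝ} (hθ : 0 < θ)
    (hf1 : ∀ x, ∑ ω, (∑ a, f x a ω) ^ 2 ≤ θ) :
    ∑ i, ∑ ω, (∑ x, ∑ a, projKernel E π i x a * f x a ω) ^ 2 ≤ (1 - ε ^ 2 / 16) * θ := by
  have hm : (0 : ℝ) < E.card := by exact_mod_cast hE.card_pos
  have h := sum_sq_nbrAvg_le_mul E π hε hval f hf hθ hf1
  rw [sum_snd_eq_sum_card_mul E (fun y => ∑ ω, ∑ b,
    (nbrAvg E (fun e => ∑ a, if π e.1 e.2 a = b then f e.1 a ω else 0) y) ^ 2)] at h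
  have key : ∀ y b ω, (E.card : ℝ) * (∑ x, ∑ a, projKernel E π (y, b) x a * f x a ω) ^ 2 =
      ((E.filter fun e => e.2 = y).card : ℝ) *
        (nbrAvg E (fun e => ∑ a, if π e.1 e.2 a = b then f e.1 a ω else 0) y) ^ 2 := by
    intro y b ω
    have h1 : ∑ x, ∑ a, projKernel E π (y, b) x a * f x a ω =
        (√(E.card * (E.filter fun e => e.2 = y).card))⁻¹ *
          ∑ e ∈ E.filter (fun e => e.2 = y), ∑ a, if π e.1 e.2 a = b then f e.1 a ω else 0 := by
      rw [sum_filter_snd_eq E y (fun e => ∑ a, if π e.1 e.2 a = b then f e.1 a ω else 0),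
        Finset.mul_sum]
      refine Finset.sum_congr rfl fun x _ => ?_
      by_cases hx : (x, y) ∈ E
      · simp only [projKernel, hx, true_and, if_true, ite_mul, zero_mul, Finset.mul_sum, mul_ite,
          mul_zero]
      · simp [projKernel, hx]
    rw [h1, nbrAvg, mul_pow, mul_pow, inv_pow, Real.sq_sqrt (by positivity)]
    by_cases hc : (E.filter fun e => e.2 = y).card = 0
    · rw [hc]; simp
    · have : ((E.filter fun e => e.2 = y).card : ℝ) ≠ 0 := by exact_mod_cast hc
      field_simp
  refine le_of_mul_le_mul_left ?_ hm
  refine le_trans (le_of_eq ?_) (h.trans (le_of_eq (by ring)))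
  rw [Fintype.sum_prod_type, Finset.mul_sum]
  refine Finset.sum_congr rfl fun y _ => ?_
  rw [Finset.sum_comm]
  simp only [Finset.mul_sum]
  exact Finset.sum_congr rfl fun ω _ => Finset.sum_congr rfl fun b _ => key y b ω

theorem sum_piFin_succ {α : Type*} [Fintype α] {r : ℕ} (F : (Fin (r + 1) → α) → ℝ) :
    ∑ v, F v = ∑ a, ∑ w : Fin r → α, F (Fin.cons a w) := by
  rw [← (Fin.consEquiv fun _ => α).sum_comp, Fintype.sum_prod_type]
  rfl

theorem sum_sq_tensor_le {I : Type u₁} {X A : Type*} [Fintype I] [Fintype X] [Fintype A]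
    (K : I → X → A → ℝ) (hK0 : ∀ i x a, 0 ≤ K i x a) {c : ℝ} (hc : 0 < c)
    (hK : ∀ (Ω : Type u₁) [Fintype Ω] (θ : ℝ), 0 < θ → ∀ f : X → A → Ω → ℝ,
      (∀ x a ω, 0 ≤ f x a ω) → (∀ x, ∑ ω, (∑ a, f x a ω) ^ 2 ≤ θ) →
      ∑ i, ∑ ω, (∑ x, ∑ a, K i x a * f x a ω) ^ 2 ≤ c * θ)
    {θ : ℝ} (hθ : 0 < θ) (r : ℕ) :
    ∀ f : (Fin r → X) → (Fin r → A) → ℝ, (∀ xs as, 0 ≤ f xs as) →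
      (∀ xs, ∑ as, f xs as ≤ θ) →
      ∑ is : Fin r → I, (∑ xs, ∑ as, (∏ j, K (is j) (xs j) (as j)) * f xs as) ^ 2 ≤
        c ^ r * θ ^ 2 := by
  induction r with
  | zero =>
    intro f hf hf1
    have h := hf1 default
    simp only [Fintype.sum_unique, Finset.univ_eq_empty, Finset.prod_empty, one_mul, pow_zero]
      at h ⊢
    exact pow_le_pow_left₀ (hf _ _) h 2
  | succ r ih =>
    intro f hf hf1
    have h := hK (Fin r → I) (c ^ r * θ ^ 2) (by positivity)
      (fun x a js => ∑ xs, ∑ as, (∏ j, K (js j) (xs j) (as j)) * f (Fin.cons x xs) (Fin.cons a as))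
      (fun x a js => Finset.sum_nonneg fun xs _ => Finset.sum_nonneg fun as _ =>
        mul_nonneg (Finset.prod_nonneg fun j _ => hK0 _ _ _) (hf _ _)) ?_
    · refine le_trans (le_of_eq ?_) (h.trans (le_of_eq (by ring)))
      rw [sum_piFin_succ]
      refine Finset.sum_congr rfl fun i _ => Finset.sum_congr rfl fun js _ => ?_
      congr 1
      rw [sum_piFin_succ]
      refine Finset.sum_congr rfl fun x _ => ?_
      simp only [Finset.mul_sum]
      rw [Finset.sum_comm (s := (univ : Finset A))]
      refine Finset.sum_congr rfl fun xs _ => ?_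
      rw [sum_piFin_succ]
      refine Finset.sum_congr rfl fun a _ => Finset.sum_congr rfl fun as _ => ?_
      simp only [Fin.prod_univ_succ, Fin.cons_zero, Fin.cons_succ]
      ring
    · intro x
      refine le_trans (le_of_eq ?_) (ih (fun xs as => ∑ a, f (Fin.cons x xs) (Fin.cons a as))
        (fun xs as => Finset.sum_nonneg fun a _ => hf _ _) fun xs => ?_)
      · refine Finset.sum_congr rfl fun js _ => ?_
        congr 1
        rw [Finset.sum_comm]
        refine Finset.sum_congr rfl fun xs _ => ?_
        rw [Finset.sum_comm]
        simp only [Finset.mul_sum]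
      · rw [Finset.sum_comm, ← sum_piFin_succ (f (Fin.cons x xs : Fin (r + 1) → X))]
        exact hf1 _

theorem sum_prod_card_filter_eq {X Y : Type*} [Fintype Y] (E : Finset (X × Y)) (r : ℕ) :
    ∑ ys : Fin r → Y, ∏ j, ((E.filter fun e => e.2 = ys j).card : ℝ) = (E.card : ℝ) ^ r := by
  have h1 : ∑ y, ((E.filter fun e => e.2 = y).card : ℝ) = E.card := by
    have := sum_snd_eq_sum_card_mul E (fun _ => (1 : ℝ))
    simpa using this.symm
  rw [← h1, Finset.sum_pow', Fintype.piFinset_univ]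

theorem sum_sq_prod_card_mul_le {X Y B : Type*} [Fintype Y] [Fintype B] (E : Finset (X × Y))
    (r : ℕ) (g : (Fin r → Y) → (Fin r → B) → ℝ) (hg : ∀ ys bs, 0 ≤ g ys bs) {θ : ℝ}
    (hg1 : ∀ ys, ∑ bs, g ys bs ≤ θ) :
    ∑ ys : Fin r → Y, ∑ bs, (∏ j, (E.card * ((E.filter fun e => e.2 = ys j).card : ℝ))) *
      g ys bs ^ 2 ≤ (E.card : ℝ) ^ (2 * r) * θ ^ 2 := by
  calc _ ≤ ∑ ys : Fin r → Y,
        (∏ j, (E.card * ((E.filter fun e => e.2 = ys j).card : ℝ))) * θ ^ 2 := by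
        refine Finset.sum_le_sum fun ys _ => ?_
        rw [← Finset.mul_sum]
        refine mul_le_mul_of_nonneg_left ?_ (Finset.prod_nonneg fun j _ => by positivity)
        calc ∑ bs, g ys bs ^ 2 ≤ (∑ bs, g ys bs) ^ 2 :=
              Finset.sum_sq_le_sq_sum_of_nonneg fun bs _ => hg ys bs
          _ ≤ θ ^ 2 := pow_le_pow_left₀ (Finset.sum_nonneg fun bs _ => hg ys bs) (hg1 ys) 2
    _ = _ := by
        rw [← Finset.sum_mul]
        congr 1
        simp only [Finset.prod_mul_distrib, Finset.prod_const, Finset.card_univ, Fintype.card_fin]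
        rw [← Finset.mul_sum, sum_prod_card_filter_eq]
        ring

/-- The unnormalised constraint indicator of a projection game. -/
def projInd {X Y A B : Type*} (E : Finset (X × Y)) (π : X → Y → A → B) (y : Y) (b : B) (x : X)
    (a : A) : ℝ :=
  if (x, y) ∈ E ∧ π x y a = b then 1 else 0

theorem projInd_eq {X Y A B : Type*} (E : Finset (X × Y)) (π : X → Y → A → B) (y : Y) (b : B)
    (x : X) (a : A) :
    projInd E π y b x a =
      √(E.card * (E.filter fun e => e.2 = y).card) * projKernel E π (y, b) x a := by
  unfold projInd projKernel
  by_cases h : (x, y) ∈ E ∧ π x y a = b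
  · have h1 : (0 : ℝ) < E.card := by exact_mod_cast Finset.card_pos.2 ⟨_, h.1⟩
    have h2 : (0 : ℝ) < (E.filter fun e => e.2 = y).card := by
      rw [Nat.cast_pos, Finset.card_pos]
      exact ⟨(x, y), mem_filter.2 ⟨h.1, rfl⟩⟩
    rw [if_pos h, if_pos h, mul_inv_cancel₀ (Real.sqrt_pos.2 (mul_pos h1 h2)).ne']
  · rw [if_neg h, if_neg h, mul_zero]

theorem sq_sum_projInd_le {X : Type*} {Y B : Type*} {A : Type*} [Fintype X] [Fintype Y]
    [Fintype A] [Fintype B] [Nonempty A] [Nonempty B] (E : Finset (X × Y)) (hE : E.Nonempty)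
    (π : X → Y → A → B) {ε : ℝ} (hε : 0 ≤ ε) (hε1 : ε ≤ 1)
    (hval : ∀ (φ : X → A) (ψ : Y → B),
      ε * E.card ≤ ∑ e ∈ E, (if π e.1 e.2 (φ e.1) = ψ e.2 then (0 : ℝ) else 1))
    (r : ℕ) (f : (Fin r → X) → (Fin r → A) → ℝ) (hf : ∀ xs as, 0 ≤ f xs as) {θ₁ : ℝ}
    (hθ₁ : 0 < θ₁) (hf1 : ∀ xs, ∑ as, f xs as ≤ θ₁)
    (g : (Fin r → Y) → (Fin r → B) → ℝ) (hg : ∀ ys bs, 0 ≤ g ys bs) {θ₂ : ℝ}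
    (hg1 : ∀ ys, ∑ bs, g ys bs ≤ θ₂) :
    (∑ ys, ∑ bs, ∑ xs, ∑ as, (∏ j, projInd E π (ys j) (bs j) (xs j) (as j)) *
        (f xs as * g ys bs)) ^ 2 ≤
      (E.card : ℝ) ^ (2 * r) * (1 - ε ^ 2 / 16) ^ r * (θ₁ * θ₂) ^ 2 := by
  set w : (Fin r → Y) → ℝ := fun ys =>
    ∏ j, √(E.card * (E.filter fun e => e.2 = ys j).card) with hw
  set u : (Fin r → Y) → (Fin r → B) → ℝ := fun ys bs =>
    ∑ xs, ∑ as, (∏ j, projKernel E π (ys j, bs j) (xs j) (as j)) * f xs as with hu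
  have hc : 0 < 1 - ε ^ 2 / 16 := by nlinarith
  have hT := sum_sq_tensor_le (projKernel E π) (projKernel_nonneg E π) hc
    (fun Ω _ θ hθ f hf hf1 => sum_sq_projKernel_le E hE π hε hval f hf hθ hf1) hθ₁ r f hf hf1
  rw [← (Equiv.arrowProdEquivProdArrow (Fin r) (fun _ => Y) (fun _ => B)).symm.sum_comp,
    Fintype.sum_prod_type] at hT
  have hT' : ∑ ys, ∑ bs, u ys bs ^ 2 ≤ (1 - ε ^ 2 / 16) ^ r * θ₁ ^ 2 := hT
  have hG : ∑ ys, ∑ bs, (w ys * g ys bs) ^ 2 ≤ (E.card : ℝ) ^ (2 * r) * θ₂ ^ 2 := by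
    refine le_trans (le_of_eq ?_) (sum_sq_prod_card_mul_le E r g hg hg1)
    refine Finset.sum_congr rfl fun ys _ => Finset.sum_congr rfl fun bs _ => ?_
    rw [mul_pow, hw, ← Finset.prod_pow]
    congr 1
    exact Finset.prod_congr rfl fun j _ => Real.sq_sqrt (by positivity)
  have heq : ∑ ys, ∑ bs, ∑ xs, ∑ as, (∏ j, projInd E π (ys j) (bs j) (xs j) (as j)) *
        (f xs as * g ys bs) = ∑ ys, ∑ bs, (w ys * g ys bs) * u ys bs := by
    refine Finset.sum_congr rfl fun ys _ => Finset.sum_congr rfl fun bs _ => ?_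
    simp only [hu, Finset.mul_sum, projInd_eq, Finset.prod_mul_distrib, hw]
    refine Finset.sum_congr rfl fun xs _ => Finset.sum_congr rfl fun as _ => ?_
    ring
  have cs := Finset.sum_mul_sq_le_sq_mul_sq (univ ×ˢ univ : Finset ((Fin r → Y) × (Fin r → B)))
    (fun z => w z.1 * g z.1 z.2) (fun z => u z.1 z.2)
  simp only [Finset.sum_product] at cs
  rw [heq]
  refine cs.trans ((mul_le_mul hG hT' (Finset.sum_nonneg fun _ _ => Finset.sum_nonneg fun _ _ =>
    sq_nonneg _) (by positivity)).trans (le_of_eq (by ring)))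

/-- The number of `k`-sets containing the distinct entries of `xs` whose assignment `σ` restricts to
`as` on these entries. -/
def tupleCount {X A : Type*} [Fintype X] (k : ℕ) (σ : Finset X → X → A) {r : ℕ}
    (xs : Fin r → X) (as : Fin r → A) : ℝ :=
  ∑ S ∈ powersetCard k (univ : Finset X),
    if (Function.Injective xs ∧ ∀ j, xs j ∈ S) ∧ (fun j => σ S (xs j)) = as then 1 else 0

theorem tupleCount_nonneg {X A : Type*} [Fintype X] (k : ℕ) (σ : Finset X → X → A) {r : ℕ}
    (xs : Fin r → X) (as : Fin r → A) : 0 ≤ tupleCount k σ xs as :=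
  Finset.sum_nonneg fun S _ => by split_ifs <;> norm_num

theorem sum_tupleCount_le {X A : Type*} [Fintype X] [Nonempty X] [Fintype A] {k : ℕ}
    (hk : k ≤ Fintype.card X) (σ : Finset X → X → A) {r : ℕ} (xs : Fin r → X) :
    ∑ as, tupleCount k σ xs as ≤
      (Fintype.card X).choose k * ((k : ℝ) / Fintype.card X) ^ r := by
  unfold tupleCount
  rw [Finset.sum_comm]
  by_cases hinj : Function.Injective xs
  · have h := card_superset_le (univ.image xs) hk
    rw [Finset.card_image_of_injective _ hinj, Finset.card_univ, Fintype.card_fin,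
      Finset.card_filter, Nat.cast_sum] at h
    refine le_trans (le_of_eq (Finset.sum_congr rfl fun S _ => ?_)) h
    have : univ.image xs ⊆ S ↔ ∀ j, xs j ∈ S := by
      simp [Finset.image_subset_iff]
    by_cases hS : ∀ j, xs j ∈ S
    · simp [hinj, hS, this]
    · simp [hinj, hS, this]
  · simp only [hinj, false_and, if_false, Finset.sum_const_zero]
    positivity

theorem sum_win_mul_card_ErSet_le {X Y A B : Type*} [Fintype X] [Fintype Y] [Fintype A]
    [Fintype B] (E : Finset (X × Y)) (π : X → Y → A → B) (k l r : ℕ)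
    (σ : Finset X → X → A) (τ : Finset Y → Y → B) :
    ∑ S ∈ powersetCard k (univ : Finset X), ∑ T ∈ powersetCard l (univ : Finset Y),
        (if ∀ x ∈ S, ∀ y ∈ T, (x, y) ∈ E → π x y (σ S x) = τ T y then (1 : ℝ) else 0) *
          (ErSet (E.filter fun e => e.1 ∈ S ∧ e.2 ∈ T) r).card ≤
      ∑ ys : Fin r → Y, ∑ bs, ∑ xs : Fin r → X, ∑ as,
        (∏ j, projInd E π (ys j) (bs j) (xs j) (as j)) *
          (tupleCount k σ xs as * tupleCount l τ ys bs) := by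
  have hJ : ∀ (ys : Fin r → Y) (bs : Fin r → B) (xs : Fin r → X) (as : Fin r → A),
      0 ≤ ∏ j, projInd E π (ys j) (bs j) (xs j) (as j) := fun ys bs xs as =>
    Finset.prod_nonneg fun j _ => by unfold projInd; split_ifs <;> norm_num
  set fS : Finset X → (Fin r → X) → (Fin r → A) → ℝ := fun S xs as =>
    if (Function.Injective xs ∧ ∀ j, xs j ∈ S) ∧ (fun j => σ S (xs j)) = as then 1 else 0 with hfS
  set gT : Finset Y → (Fin r → Y) → (Fin r → B) → ℝ := fun T ys bs =>
    if (Function.Injective ys ∧ ∀ j, ys j ∈ T) ∧ (fun j => τ T (ys j)) = bs then 1 else 0 with hgT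
  have hf0 : ∀ S xs as, 0 ≤ fS S xs as := fun S xs as => by
    simp only [hfS]; split_ifs <;> norm_num
  have hg0 : ∀ T ys bs, 0 ≤ gT T ys bs := fun T ys bs => by
    simp only [hgT]; split_ifs <;> norm_num
  have hterm : ∀ S T, (if ∀ x ∈ S, ∀ y ∈ T, (x, y) ∈ E → π x y (σ S x) = τ T y then (1 : ℝ)
        else 0) * (ErSet (E.filter fun e => e.1 ∈ S ∧ e.2 ∈ T) r).card ≤
      ∑ ys : Fin r → Y, ∑ bs, ∑ xs : Fin r → X, ∑ as,
        (∏ j, projInd E π (ys j) (bs j) (xs j) (as j)) * (fS S xs as * gT T ys bs) := by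
    intro S T
    have hpos : ∀ (ys : Fin r → Y) (bs : Fin r → B) (xs : Fin r → X) (as : Fin r → A),
        0 ≤ (∏ j, projInd E π (ys j) (bs j) (xs j) (as j)) * (fS S xs as * gT T ys bs) :=
      fun ys bs xs as => mul_nonneg (hJ _ _ _ _) (mul_nonneg (hf0 _ _ _) (hg0 _ _ _))
    split_ifs with hwin
    · rw [one_mul, ErSet, Finset.card_filter, Nat.cast_sum, Fintype.sum_prod_type, Finset.sum_comm]
      refine Finset.sum_le_sum fun ys _ => ?_
      refine le_trans ?_ (Finset.single_le_sum (fun bs _ => Finset.sum_nonneg fun xs _ =>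
        Finset.sum_nonneg fun as _ => hpos ys bs xs as) (mem_univ fun j => τ T (ys j)))
      refine Finset.sum_le_sum fun xs _ => ?_
      refine le_trans ?_ (Finset.single_le_sum (fun as _ => hpos ys (fun j => τ T (ys j)) xs as)
        (mem_univ fun j => σ S (xs j)))
      split_ifs with h
      · obtain ⟨hE, hx, hy⟩ := h
        have hE' : ∀ i, (xs i, ys i) ∈ E ∧ xs i ∈ S ∧ ys i ∈ T := fun i => by
          simpa using hE i
        have h1 : ∏ j, projInd E π (ys j) (τ T (ys j)) (xs j) (σ S (xs j)) = 1 :=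
          Finset.prod_eq_one fun j _ => if_pos ⟨(hE' j).1,
            hwin _ (hE' j).2.1 _ (hE' j).2.2 (hE' j).1⟩
        have h2 : fS S xs (fun j => σ S (xs j)) = 1 := if_pos ⟨⟨hx, fun j => (hE' j).2.1⟩, rfl⟩
        have h3 : gT T ys (fun j => τ T (ys j)) = 1 := if_pos ⟨⟨hy, fun j => (hE' j).2.2⟩, rfl⟩
        rw [h1, h2, h3]
        norm_num
      · rw [Nat.cast_zero]
        exact hpos _ _ _ _
    · rw [zero_mul]
      exact Finset.sum_nonneg fun ys _ => Finset.sum_nonneg fun bs _ => Finset.sum_nonneg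
        fun xs _ => Finset.sum_nonneg fun as _ => hpos ys bs xs as
  refine (Finset.sum_le_sum fun S _ => Finset.sum_le_sum fun T _ => hterm S T).trans
    (le_of_eq ?_)
  have hprod : ∀ (xs : Fin r → X) as (ys : Fin r → Y) bs,
      tupleCount k σ xs as * tupleCount l τ ys bs =
      ∑ S ∈ powersetCard k (univ : Finset X), ∑ T ∈ powersetCard l (univ : Finset Y),
        fS S xs as * gT T ys bs := fun xs as ys bs => by
    rw [tupleCount, tupleCount, Finset.sum_mul_sum]
  simp only [hprod, Finset.mul_sum]
  rw [← Finset.sum_product' (s := powersetCard k (univ : Finset X))]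
  simp only [← Finset.sum_product' (s := powersetCard k (univ : Finset X))]
  rw [Finset.sum_comm]
  refine Finset.sum_congr rfl fun ys _ => ?_
  rw [Finset.sum_comm]
  refine Finset.sum_congr rfl fun bs _ => ?_
  rw [Finset.sum_comm]
  refine Finset.sum_congr rfl fun xs _ => ?_
  rw [Finset.sum_comm]

theorem exp_neg_two_mul_le_one_sub {x : ℝ} (h0 : 0 ≤ x) (h1 : x ≤ 1 / 2) :
    Real.exp (-(2 * x)) ≤ 1 - x := by
  rw [Real.exp_neg, inv_le_comm₀ (Real.exp_pos _) (by linarith)]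
  refine le_trans ?_ (Real.add_one_le_exp (2 * x))
  rw [inv_le_iff_one_le_mul₀ (by linarith)]
  nlinarith

theorem sum_win_mul_card_ErSet_le_exp {X Y A B : Type*} [Fintype X] [Fintype Y] [Fintype A]
    [Fintype B] [Nonempty A] [Nonempty B] (E : Finset (X × Y)) (hE : E.Nonempty)
    (π : X → Y → A → B) {ε : ℝ} (hε : 0 ≤ ε) (hε1 : ε ≤ 1)
    (hval : ∀ (φ : X → A) (ψ : Y → B),
      ε * E.card ≤ ∑ e ∈ E, (if π e.1 e.2 (φ e.1) = ψ e.2 then (0 : ℝ) else 1))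
    {k l : ℕ} (hk0 : 0 < k) (hk : k ≤ Fintype.card X) (hl : l ≤ Fintype.card Y)
    (r : ℕ) (σ : Finset X → X → A) (τ : Finset Y → Y → B) :
    ∑ S ∈ powersetCard k (univ : Finset X), ∑ T ∈ powersetCard l (univ : Finset Y),
        (if ∀ x ∈ S, ∀ y ∈ T, (x, y) ∈ E → π x y (σ S x) = τ T y then (1 : ℝ) else 0) *
          (ErSet (E.filter fun e => e.1 ∈ S ∧ e.2 ∈ T) r).card ≤
      (Fintype.card X).choose k * (Fintype.card Y).choose l *
        ((k : ℝ) * l * E.card / (Fintype.card X * Fintype.card Y)) ^ r *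
          Real.exp (-(ε ^ 2 * r / 32)) := by
  obtain ⟨e₀, he₀⟩ := hE
  have hX : Nonempty X := ⟨e₀.1⟩
  have hY : Nonempty Y := ⟨e₀.2⟩
  have hcX : (0 : ℝ) < Fintype.card X := by exact_mod_cast Fintype.card_pos
  have hch : (0 : ℝ) < (Fintype.card X).choose k := by exact_mod_cast Nat.choose_pos hk
  have hk0' : (0 : ℝ) < k := by exact_mod_cast hk0
  refine (sum_win_mul_card_ErSet_le E π k l r σ τ).trans ?_
  refine (abs_le_of_sq_le_sq' ((sq_sum_projInd_le E ⟨e₀, he₀⟩ π hε hε1 hval r _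
    (tupleCount_nonneg k σ) (θ₁ := (Fintype.card X).choose k * ((k : ℝ) / Fintype.card X) ^ r)
    (by positivity) (sum_tupleCount_le hk σ) _ (tupleCount_nonneg l τ)
    (sum_tupleCount_le hl τ)).trans ?_) (by positivity)).2
  have hexp : (1 - ε ^ 2 / 16) ^ r ≤ Real.exp (-(ε ^ 2 * r / 32)) ^ 2 := by
    have h1 : 1 - ε ^ 2 / 16 ≤ Real.exp (-(ε ^ 2 / 16)) := by
      linarith [Real.add_one_le_exp (-(ε ^ 2 / 16))]
    refine (pow_le_pow_left₀ (by nlinarith) h1 r).trans (le_of_eq ?_)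
    rw [← Real.exp_nat_mul, ← Real.exp_nat_mul]
    congr 1
    push_cast
    ring
  rw [mul_pow _ (Real.exp _)]
  refine le_trans (le_of_eq ?_) (mul_le_mul_of_nonneg_left hexp (sq_nonneg _))
  rw [div_pow, div_pow, div_pow]
  have hcY : (0 : ℝ) < Fintype.card Y := by exact_mod_cast Fintype.card_pos
  field_simp
  ring

theorem sum_win_le {X Y A B : Type*} [Fintype X] [Fintype Y] [Fintype A]
    [Fintype B] [Nonempty A] [Nonempty B] (E : Finset (X × Y)) (hE : E.Nonempty)
    (π : X → Y → A → B) {ε : ℝ} (hε : 0 ≤ ε) (hε1 : ε ≤ 1)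
    (hval : ∀ (φ : X → A) (ψ : Y → B),
      ε * E.card ≤ ∑ e ∈ E, (if π e.1 e.2 (φ e.1) = ψ e.2 then (0 : ℝ) else 1))
    {d : ℝ} (hd : 0 < d)
    (hdX : ∀ x, ((E.filter fun e => e.1 = x).card : ℝ) ≤ d)
    (hdY : ∀ y, ((E.filter fun e => e.2 = y).card : ℝ) ≤ d)
    {k l : ℕ} (hk0 : 0 < k) (hl0 : 0 < l) (hk : k ≤ Fintype.card X) (hl : l ≤ Fintype.card Y)
    {μ : ℝ} (hμ : μ = (k : ℝ) * l * E.card / (d * Fintype.card X * Fintype.card Y))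
    (σ : Finset X → X → A) (τ : Finset Y → Y → B) :
    ∑ S ∈ powersetCard k (univ : Finset X), ∑ T ∈ powersetCard l (univ : Finset Y),
        (if ∀ x ∈ S, ∀ y ∈ T, (x, y) ∈ E → π x y (σ S x) = τ T y then (1 : ℝ) else 0) ≤
      (Fintype.card X).choose k * (Fintype.card Y).choose l *
        (4 * Real.exp (-(ε ^ 4 * μ / 2 ^ 18))) := by
  have hcX : (0 : ℝ) < Fintype.card X := by exact_mod_cast hk0.trans_le hk
  have hcY : (0 : ℝ) < Fintype.card Y := by exact_mod_cast hl0.trans_le hl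
  have hk0' : (0 : ℝ) < k := by exact_mod_cast hk0
  have hl0' : (0 : ℝ) < l := by exact_mod_cast hl0
  have hm : (0 : ℝ) < E.card := by exact_mod_cast hE.card_pos
  have hμ0 : 0 < μ := by rw [hμ]; positivity
  have hs : (k : ℝ) * l * E.card / (Fintype.card X * Fintype.card Y) = d * μ := by
    rw [hμ]; field_simp
  set C : ℝ := (Fintype.card X).choose k * (Fintype.card Y).choose l with hC
  have hC0 : 0 ≤ C := by positivity
  have hε2 : ε ^ 2 ≤ 1 := pow_le_one₀ hε hε1
  set δ : ℝ := ε ^ 2 / 256 with hδ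
  have hδ0 : 0 ≤ δ := by positivity
  have hδ1 : δ ≤ 1 / 256 := by rw [hδ]; linarith
  set r : ℕ := ⌊δ * μ / 2⌋₊ with hr
  have hr1 : (r : ℝ) ≤ δ * μ / 2 := Nat.floor_le (by positivity)
  have hr2 : δ * μ / 2 < r + 1 := Nat.lt_floor_add_one _
  set W : Finset X → Finset Y → ℝ := fun S T =>
    if ∀ x ∈ S, ∀ y ∈ T, (x, y) ∈ E → π x y (σ S x) = τ T y then (1 : ℝ) else 0 with hW
  set bad : Finset X → Finset Y → ℝ := fun S T =>
    if (edgeCount E S T : ℝ) < (1 - δ) * (d * μ) then (1 : ℝ) else 0 with hbad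
  set N : Finset X → Finset Y → ℝ := fun S T =>
    ((ErSet (E.filter fun e => e.1 ∈ S ∧ e.2 ∈ T) r).card : ℝ) with hN
  set c : ℝ := ((1 - 2 * δ) * (d * μ)) ^ r with hc
  have hbase : 0 < (1 - 2 * δ) * (d * μ) := mul_pos (by linarith) (by positivity)
  have hc0 : 0 < c := by positivity
  have hW0 : ∀ S T, 0 ≤ W S T := fun S T => by simp only [hW]; split_ifs <;> norm_num
  have hW1 : ∀ S T, W S T ≤ 1 := fun S T => by simp only [hW]; split_ifs <;> norm_num
  have hpt : ∀ S T, c * W S T ≤ c * bad S T + W S T * N S T := by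
    intro S T
    by_cases hb : (edgeCount E S T : ℝ) < (1 - δ) * (d * μ)
    · have h1 : bad S T = 1 := if_pos hb
      rw [h1]
      have h2 := mul_le_mul_of_nonneg_left (hW1 S T) hc0.le
      have h3 : 0 ≤ W S T * N S T := mul_nonneg (hW0 S T) (Nat.cast_nonneg _)
      linarith
    · have h1 : bad S T = 0 := if_neg hb
      have h2 : c ≤ N S T := by
        refine card_ErSet_ge _ hd.le (fun x => le_trans ?_ (hdX x)) (fun y => le_trans ?_ (hdY y))
          hbase.le r ?_
        · exact_mod_cast Finset.card_le_card
            (Finset.filter_subset_filter _ (Finset.filter_subset _ _))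
        · exact_mod_cast Finset.card_le_card
            (Finset.filter_subset_filter _ (Finset.filter_subset _ _))
        · have h3 : (1 - δ) * (d * μ) ≤ edgeCount E S T := not_lt.1 hb
          have h4 : 2 * (r : ℝ) * d ≤ δ * (d * μ) := by nlinarith
          unfold edgeCount at h3
          linarith
      rw [h1, mul_zero, zero_add, mul_comm]
      exact mul_le_mul_of_nonneg_left h2 (hW0 S T)
  have hsum : c * ∑ S ∈ powersetCard k (univ : Finset X), ∑ T ∈ powersetCard l (univ : Finset Y),
      W S T ≤ c * (C * Real.exp (-(δ ^ 2 * μ / 4))) +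
        C * (d * μ) ^ r * Real.exp (-(ε ^ 2 * r / 32)) := by
    have h1 := card_edgeCount_lt_le E hE hd hdX hdY hk hl hδ0 (by linarith) hμ
    have h2 := sum_win_mul_card_ErSet_le_exp E hE π hε hε1 hval hk0 hk hl r σ τ
    rw [hs] at h2
    refine le_trans ?_ (add_le_add (mul_le_mul_of_nonneg_left h1 hc0.le) h2)
    simp only [Finset.mul_sum, ← Finset.sum_add_distrib]
    exact Finset.sum_le_sum fun S _ => Finset.sum_le_sum fun T _ => hpt S T
  have hcE : (d * μ) ^ r ≤ c * Real.exp (4 * δ * r) := by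
    have h1 : Real.exp (-(4 * δ * r)) ≤ (1 - 2 * δ) ^ r := by
      have := pow_le_pow_left₀ (Real.exp_pos _).le
        (exp_neg_two_mul_le_one_sub (x := 2 * δ) (by linarith) (by linarith)) r
      refine le_trans (le_of_eq ?_) this
      rw [← Real.exp_nat_mul]
      congr 1
      ring
    have h2 : 1 ≤ (1 - 2 * δ) ^ r * Real.exp (4 * δ * r) := by
      calc (1 : ℝ) = Real.exp (-(4 * δ * r)) * Real.exp (4 * δ * r) := by
            rw [← Real.exp_add]; simp
        _ ≤ _ := mul_le_mul_of_nonneg_right h1 (Real.exp_pos _).le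
    calc (d * μ) ^ r ≤ (d * μ) ^ r * ((1 - 2 * δ) ^ r * Real.exp (4 * δ * r)) :=
          le_mul_of_one_le_right (by positivity) h2
      _ = c * Real.exp (4 * δ * r) := by rw [hc, mul_pow (1 - 2 * δ)]; ring
  have hexp2 : Real.exp (4 * δ * r) * Real.exp (-(ε ^ 2 * r / 32)) ≤
      3 * Real.exp (-(ε ^ 4 * μ / 2 ^ 18)) := by
    have h3 : Real.exp 1 ≤ 3 := by linarith [Real.exp_one_lt_d9]
    refine le_trans ?_ (mul_le_mul_of_nonneg_right h3 (Real.exp_pos _).le)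
    rw [← Real.exp_add, ← Real.exp_add, Real.exp_le_exp]
    have h4 : ε ^ 2 * (δ * μ / 2) ≤ ε ^ 2 * (r + 1) :=
      mul_le_mul_of_nonneg_left hr2.le (sq_nonneg _)
    have h5 : 0 ≤ ε ^ 4 * μ := by positivity
    have h6 : ε ^ 2 * (δ * μ / 2) = ε ^ 4 * μ / 512 := by rw [hδ]; ring
    rw [h6] at h4
    have h7 : 4 * δ * r = ε ^ 2 * r / 64 := by rw [hδ]; ring
    rw [h7]
    norm_num
    linarith
  refine le_of_mul_le_mul_left (hsum.trans ?_) hc0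
  have hb : Real.exp (-(δ ^ 2 * μ / 4)) = Real.exp (-(ε ^ 4 * μ / 2 ^ 18)) := by
    congr 1; rw [hδ]; ring
  rw [hb]
  calc _ ≤ c * (C * Real.exp (-(ε ^ 4 * μ / 2 ^ 18))) +
        C * (c * Real.exp (4 * δ * r)) * Real.exp (-(ε ^ 2 * r / 32)) := by gcongr
    _ = c * C * (Real.exp (-(ε ^ 4 * μ / 2 ^ 18)) +
        Real.exp (4 * δ * r) * Real.exp (-(ε ^ 2 * r / 32))) := by ring
    _ ≤ c * C * (Real.exp (-(ε ^ 4 * μ / 2 ^ 18)) + 3 * Real.exp (-(ε ^ 4 * μ / 2 ^ 18))) := by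
        gcongr
    _ = _ := by ring

theorem gameVal_le {QX QY AX AY : Type*} [Fintype QX] [Fintype QY] [Fintype AX] [Fintype AY]
    [Nonempty AX] [Nonempty AY] {Q : QX → QY → ℝ} {P : QX → QY → AX → AY → Prop} {c : ℝ}
    (h : ∀ (φ : QX → AX) (ψ : QY → AY),
      ∑ x, ∑ y, Q x y * (if P x y (φ x) (ψ y) then 1 else 0) ≤ c) :
    gameVal Q P ≤ c :=
  Finset.sup'_le _ _ fun p _ => h p.1 p.2

theorem le_gameVal {QX QY AX AY : Type*} [Fintype QX] [Fintype QY] [Fintype AX] [Fintype AY]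
    [Nonempty AX] [Nonempty AY] (Q : QX → QY → ℝ) (P : QX → QY → AX → AY → Prop)
    (φ : QX → AX) (ψ : QY → AY) :
    ∑ x, ∑ y, Q x y * (if P x y (φ x) (ψ y) then 1 else 0) ≤ gameVal Q P :=
  Finset.le_sup' (fun p : (QX → AX) × (QY → AY) =>
    ∑ x, ∑ y, Q x y * (if P x y (p.1 x) (p.2 y) then 1 else 0)) (mem_univ (φ, ψ))

theorem sum_unifOn_mul {X Y : Type*} [Fintype X] [Fintype Y] (E : Finset (X × Y))
    (h : X → Y → ℝ) :
    ∑ x, ∑ y, unifOn E x y * h x y = (E.card : ℝ)⁻¹ * ∑ e ∈ E, h e.1 e.2 := by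
  rw [← Fintype.sum_prod_type' (f := fun x y => unifOn E x y * h x y), Finset.mul_sum]
  simp only [unifOn, ite_mul, zero_mul]
  rw [Finset.sum_ite_mem, Finset.univ_inter]

theorem birthdayVal_le {X Y AX AY : Type*} [Fintype X] [Fintype Y] [Fintype AX] [Fintype AY]
    [Nonempty AX] [Nonempty AY] (E : Finset (X × Y)) (P : X → Y → AX → AY → Prop) {k l : ℕ}
    (hk : k ≤ Fintype.card X) (hl : l ≤ Fintype.card Y) {c : ℝ}
    (h : ∀ (σ : Finset X → X → AX) (τ : Finset Y → Y → AY),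
      ∑ S ∈ powersetCard k (univ : Finset X), ∑ T ∈ powersetCard l (univ : Finset Y),
        (if bPred E P S T (σ S) (τ T) then (1 : ℝ) else 0) ≤
      (Fintype.card X).choose k * (Fintype.card Y).choose l * c) :
    birthdayVal E P k l ≤ c := by
  refine gameVal_le fun σ τ => ?_
  have hX : (0 : ℝ) < (Fintype.card X).choose k := by exact_mod_cast Nat.choose_pos hk
  have hY : (0 : ℝ) < (Fintype.card Y).choose l := by exact_mod_cast Nat.choose_pos hl
  refine le_of_mul_le_mul_left (le_trans (le_of_eq ?_) (h σ τ)) (mul_pos hX hY)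
  rw [Finset.mul_sum]
  have hpX : powersetCard k (univ : Finset X) = univ.filter fun S => S.card = k := by
    ext; simp [mem_powersetCard]
  have hpY : powersetCard l (univ : Finset Y) = univ.filter fun T => T.card = l := by
    ext; simp [mem_powersetCard]
  rw [hpX, Finset.sum_filter]
  refine Finset.sum_congr rfl fun S _ => ?_
  rw [hpY, Finset.sum_filter, Finset.mul_sum]
  by_cases hS : S.card = k
  · rw [if_pos hS]
    refine Finset.sum_congr rfl fun T _ => ?_
    by_cases hT : T.card = l
    · rw [if_pos ⟨hS, hT⟩, if_pos hT, ← mul_assoc, mul_inv_cancel₀ (mul_pos hX hY).ne', one_mul]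
    · rw [if_neg fun h => hT h.2, if_neg hT]; ring
  · rw [if_neg hS]
    refine Finset.sum_eq_zero fun T _ => ?_
    rw [if_neg fun h => hS h.1]; ring

theorem birthdayVal_le_one {X Y AX AY : Type*} [Fintype X] [Fintype Y] [Fintype AX] [Fintype AY]
    [Nonempty AX] [Nonempty AY] (E : Finset (X × Y)) (P : X → Y → AX → AY → Prop) {k l : ℕ}
    (hk : k ≤ Fintype.card X) (hl : l ≤ Fintype.card Y) : birthdayVal E P k l ≤ 1 := by
  refine birthdayVal_le E P hk hl fun σ τ => ?_
  calc _ ≤ ∑ S ∈ powersetCard k (univ : Finset X), ∑ T ∈ powersetCard l (univ : Finset Y),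
        (1 : ℝ) := Finset.sum_le_sum fun S _ => Finset.sum_le_sum fun T _ => by
          split_ifs <;> norm_num
    _ = _ := by simp [Finset.card_powersetCard]

theorem birthdayVal_nonneg {X Y AX AY : Type*} [Fintype X] [Fintype Y] [Fintype AX] [Fintype AY]
    [Nonempty AX] [Nonempty AY] (E : Finset (X × Y)) (P : X → Y → AX → AY → Prop) (k l : ℕ) :
    0 ≤ birthdayVal E P k l := by
  refine le_trans ?_ (le_gameVal _ _ (fun _ => Classical.arbitrary _) fun _ => Classical.arbitrary _)
  refine Finset.sum_nonneg fun S _ => Finset.sum_nonneg fun T _ => mul_nonneg ?_ ?_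
  · split_ifs <;> positivity
  · split_ifs <;> norm_num

theorem card_filter_fst_le_maxDeg {X Y : Type*} [Fintype X] [Fintype Y] (E : Finset (X × Y))
    (x : X) : (E.filter fun e => e.1 = x).card ≤ maxDeg E :=
  le_max_of_le_left (Finset.le_sup (f := fun x => (E.filter fun e => e.1 = x).card) (mem_univ x))

theorem card_filter_snd_le_maxDeg {X Y : Type*} [Fintype X] [Fintype Y] (E : Finset (X × Y))
    (y : Y) : (E.filter fun e => e.2 = y).card ≤ maxDeg E :=
  le_max_of_le_right (Finset.le_sup (f := fun y => (E.filter fun e => e.2 = y).card) (mem_univ y))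

theorem birthdayVal_le_exp {X Y AX AY : Type*} [Fintype X] [Fintype Y] [Fintype AX] [Fintype AY]
    [Nonempty AX] [Nonempty AY] (E : Finset (X × Y)) (P : X → Y → AX → AY → Prop) {ε : ℝ}
    (hE : E.Nonempty) (hP : ∀ x y, (x, y) ∈ E → ∃ f : AX → AY, ∀ a b, P x y a b ↔ f a = b)
    (hε : 0 ≤ ε) (hε1 : ε ≤ 1) (hval : gameVal (unifOn E) P ≤ 1 - ε) {k l : ℕ} (hk0 : 0 < k)
    (hl0 : 0 < l) (hk : k ≤ Fintype.card X) (hl : l ≤ Fintype.card Y) {μ : ℝ}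
    (hμ : μ = (k : ℝ) * l * E.card / (maxDeg E * Fintype.card X * Fintype.card Y)) :
    birthdayVal E P k l ≤ 4 * Real.exp (-(ε ^ 4 * μ / 2 ^ 18)) := by
  set π : X → Y → AX → AY := fun x y =>
    if h : (x, y) ∈ E then (hP x y h).choose else fun _ => Classical.arbitrary _ with hπ
  have hπP : ∀ x y, (x, y) ∈ E → ∀ a b, P x y a b ↔ π x y a = b := fun x y h a b => by
    simp only [hπ, dif_pos h]
    exact (hP x y h).choose_spec a b
  have hm : (0 : ℝ) < E.card := by exact_mod_cast hE.card_pos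
  have hv : ∀ (φ : X → AX) (ψ : Y → AY),
      ε * E.card ≤ ∑ e ∈ E, (if π e.1 e.2 (φ e.1) = ψ e.2 then (0 : ℝ) else 1) := by
    intro φ ψ
    have h := (le_gameVal (unifOn E) P φ ψ).trans hval
    rw [sum_unifOn_mul E (fun x y => if P x y (φ x) (ψ y) then (1 : ℝ) else 0),
      inv_mul_le_iff₀ hm] at h
    have h2 : ∑ e ∈ E, (if π e.1 e.2 (φ e.1) = ψ e.2 then (0 : ℝ) else 1) =
        E.card - ∑ e ∈ E, if P e.1 e.2 (φ e.1) (ψ e.2) then (1 : ℝ) else 0 := by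
      rw [← nsmul_one, ← Finset.sum_const, ← Finset.sum_sub_distrib]
      refine Finset.sum_congr rfl fun e he => ?_
      simp only [hπP e.1 e.2 he]
      split_ifs <;> norm_num
    rw [h2]
    linarith
  obtain ⟨e₀, he₀⟩ := hE
  have hd : (0 : ℝ) < maxDeg E := by
    have h1 : 0 < (E.filter fun e => e.1 = e₀.1).card :=
      Finset.card_pos.2 ⟨e₀, mem_filter.2 ⟨he₀, rfl⟩⟩
    exact_mod_cast h1.trans_le (card_filter_fst_le_maxDeg E e₀.1)
  refine birthdayVal_le E P hk hl fun σ τ => ?_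
  refine le_trans (le_of_eq ?_) (sum_win_le E ⟨e₀, he₀⟩ π hε hε1 hv hd
    (fun x => by exact_mod_cast card_filter_fst_le_maxDeg E x)
    (fun y => by exact_mod_cast card_filter_snd_le_maxDeg E y) hk0 hl0 hk hl hμ σ τ)
  refine Finset.sum_congr rfl fun S _ => Finset.sum_congr rfl fun T _ => ?_
  refine if_congr ?_ rfl rfl
  exact forall₂_congr fun x _ => forall₂_congr fun y _ => forall_congr' fun h => hπP x y h _ _

/-- **Birthday repetition theorem (projection games).**  There is a universal constant
`α > 0` such that for any projection game `G` whose question distribution is uniform over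
`E ⊆ X × Y`, with maximum degree `d_max` and `val(G) = 1 − ε`, for all `0 ≤ k ≤ |X|`,
`0 ≤ l ≤ |Y|`, `val(G^{k×l}) ≤ 2·(1 − ε/2)^{α·ε³·k·l·|E| / (d_max·|X|·|Y|)}`. -/
theorem birthday_repetition_theorem_projection :
    ∃ α : ℝ, 0 < α ∧
      ∀ (X : Type u₁) (Y : Type u₂) (AX : Type u₃) (AY : Type u₄)
        [Fintype X] [Fintype Y] [Fintype AX] [Fintype AY] [Nonempty AX] [Nonempty AY]
        (E : Finset (X × Y)) (P : X → Y → AX → AY → Prop) (ε : ℝ),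
        E.Nonempty →
        (∀ x y, (x, y) ∈ E → ∃ f : AX → AY, ∀ a b, P x y a b ↔ f a = b) →
        gameVal (unifOn E) P = 1 - ε →
        ∀ k l : ℕ, k ≤ Fintype.card X → l ≤ Fintype.card Y →
          birthdayVal E P k l ≤
            2 * (1 - ε / 2) ^
              (α * ε ^ 3 * (k : ℝ) * (l : ℝ) * (E.card : ℝ) /
                ((maxDeg E : ℝ) * (Fintype.card X : ℝ) * (Fintype.card Y : ℝ))) := by
  refine ⟨1 / 2 ^ 19, by norm_num, ?_⟩
  intro X Y AX AY _ _ _ _ _ _ E P ε hE hP hval k l hk hl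
  have hm : (0 : ℝ) < E.card := by exact_mod_cast hE.card_pos
  have hε : 0 ≤ ε := by
    have h : gameVal (unifOn E) P ≤ 1 := gameVal_le fun φ ψ => by
      rw [sum_unifOn_mul E (fun x y => if P x y (φ x) (ψ y) then (1 : ℝ) else 0),
        inv_mul_le_iff₀ hm, mul_one]
      calc _ ≤ ∑ e ∈ E, (1 : ℝ) := Finset.sum_le_sum fun e _ => by split_ifs <;> norm_num
        _ = _ := by simp
    linarith
  have hε1 : ε ≤ 1 := by
    have h := le_gameVal (unifOn E) P (fun _ => Classical.arbitrary _)
      fun _ => Classical.arbitrary _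
    have h0 : 0 ≤ gameVal (unifOn E) P := by
      refine le_trans (Finset.sum_nonneg fun x _ => Finset.sum_nonneg fun y _ =>
        mul_nonneg ?_ ?_) h
      · unfold unifOn; split_ifs <;> positivity
      · split_ifs <;> norm_num
    linarith
  have h1 := birthdayVal_le_one E P hk hl
  have h0 := birthdayVal_nonneg E P k l
  rcases Nat.eq_zero_or_pos k with rfl | hk0
  · norm_num; linarith
  rcases Nat.eq_zero_or_pos l with rfl | hl0
  · norm_num; linarith
  obtain ⟨μ, hμ⟩ : ∃ μ : ℝ,
      μ = (k : ℝ) * l * E.card / (maxDeg E * Fintype.card X * Fintype.card Y) := ⟨_, rfl⟩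
  have hμ0 : 0 ≤ μ := by rw [hμ]; positivity
  have hmain := birthdayVal_le_exp E P hE hP hε hε1 hval.le hk0 hl0 hk hl hμ
  have hexp : birthdayVal E P k l ≤ 2 * Real.exp (-(ε ^ 4 * μ / 2 ^ 19)) := by
    refine (abs_le_of_sq_le_sq' ?_ (by positivity)).2
    have h2 : (2 * Real.exp (-(ε ^ 4 * μ / 2 ^ 19))) ^ 2 =
        4 * Real.exp (-(ε ^ 4 * μ / 2 ^ 18)) := by
      rw [mul_pow, ← Real.exp_nat_mul]
      congr 2
      · norm_num
      · push_cast; ring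
    rw [h2]
    nlinarith
  refine hexp.trans (mul_le_mul_of_nonneg_left ?_ zero_le_two)
  have hb : Real.exp (-(2 * (ε / 2))) ≤ 1 - ε / 2 :=
    exp_neg_two_mul_le_one_sub (by linarith) (by linarith)
  refine le_trans (le_of_eq ?_) (Real.rpow_le_rpow (Real.exp_pos _).le hb (by positivity))
  rw [← Real.exp_mul]
  congr 1
  rw [hμ]
  ring
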